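/- arXiv:0905.2123 — 3 statements merged into one kernel-verified Lean document; each statement's English description precedes it below -/
import Mathlib

section
/- For any bipartite quantum state ρ_AB and any local POVM measurements {M_i^A} on A and {M_s^B} on B, the classical mutual information I{A:B} of the joint outcome distribution p_{is} = Tr((M_i^A ⊗ M_s^B) ρ_AB) satisfies I{A:B} ≤ S(ρ_A), where S(ρ_A) is the von Neumann entropy of the reduced state ρ_A = Tr_B ρ_AB. -/
open Matrix BigOperators
open scoped Kronecker Classical ComplexOrder

noncomputable section

/-- Shannon entropy (base 2, with 0 log 0 = 0). -/
def shannon {ι : Type*} [Fintype ι] (p : ι → ℝ) : ℝ :=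
  -∑ i, p i * Real.logb 2 (p i)

/-- Classical mutual information of a joint distribution. -/
def cMutualInfo {ι κ : Type*} [Fintype ι] [Fintype κ] (p : ι → κ → ℝ) : ℝ :=
  shannon (fun i => ∑ s, p i s) + shannon (fun s => ∑ i, p i s)
    - shannon (fun x : ι × κ => p x.1 x.2)

/-- Von Neumann entropy (base 2) via eigenvalues of a Hermitian matrix. -/
def vnEntropy {n : Type*} [Fintype n] [DecidableEq n] (ρ : Matrix n n ℂ) : ℝ :=
  if h : ρ.IsHermitian then shannon h.eigenvalues else 0

/-- Partial trace over the second (right) factor. -/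
def ptraceR {a b : Type*} [Fintype a] [Fintype b] (ρ : Matrix (a × b) (a × b) ℂ) :
    Matrix a a ℂ := fun i j => ∑ k, ρ (i, k) (j, k)

/-- Partial trace over the first (left) factor. -/
def ptraceL {a b : Type*} [Fintype a] [Fintype b] (ρ : Matrix (a × b) (a × b) ℂ) :
    Matrix b b ℂ := fun i j => ∑ k, ρ (k, i) (k, j)

def IsDensityMatrix {n : Type*} [Fintype n] (ρ : Matrix n n ℂ) : Prop :=
  ρ.PosSemidef ∧ ρ.trace = 1

def IsPOVM {n ι : Type*} [Fintype n] [Fintype ι] [DecidableEq n]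
    (M : ι → Matrix n n ℂ) : Prop :=
  (∀ i, (M i).PosSemidef) ∧ ∑ i, M i = 1

/-- Quantum mutual information S(A:B). -/
def qMutualInfo {a b : Type*} [Fintype a] [Fintype b] [DecidableEq a] [DecidableEq b]
    (ρ : Matrix (a × b) (a × b) ℂ) : ℝ :=
  vnEntropy (ptraceR ρ) + vnEntropy (ptraceL ρ) - vnEntropy ρ

/-- Joint outcome probability of local measurements. -/
def measProb {a b ι κ : Type*} [Fintype a] [Fintype b] [Fintype ι] [Fintype κ]
    (ρ : Matrix (a × b) (a × b) ℂ) (M : ι → Matrix a a ℂ) (N : κ → Matrix b b ℂ)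
    (i : ι) (s : κ) : ℝ := ((M i ⊗ₖ N s) * ρ).trace.re

open scoped MatrixOrder Matrix.Norms.L2Operator in
lemma Matrix.PosSemidef.exists_conjTranspose_mul_self {n : Type*} [Fintype n]
    {A : Matrix n n ℂ} (hA : A.PosSemidef) : ∃ B : Matrix n n ℂ, A = Bᴴ * B :=
  CStarAlgebra.nonneg_iff_eq_star_mul_self.mp hA.nonneg

lemma Matrix.PosSemidef.trace_mul_re_nonneg {n : Type*} [Fintype n] {A B : Matrix n n ℂ}
    (hA : A.PosSemidef) (hB : B.PosSemidef) : 0 ≤ (A * B).trace.re := by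
  obtain ⟨X, rfl⟩ := hB.exists_conjTranspose_mul_self
  rw [← Matrix.mul_assoc, Matrix.trace_mul_comm, ← Matrix.mul_assoc]
  exact (Complex.le_def.1 (hA.mul_mul_conjTranspose_same X).trace_nonneg).1

lemma Matrix.PosSemidef.trace_smul_one_sub {n : Type*} [Fintype n] [DecidableEq n]
    {A : Matrix n n ℂ} (hA : A.PosSemidef) :
    ((A.trace.re : ℂ) • (1 : Matrix n n ℂ) - A).PosSemidef := by
  have hD : (Matrix.diagonal fun k =>
      ((A.trace.re - hA.1.eigenvalues k : ℝ) : ℂ)).PosSemidef := by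
    refine Matrix.PosSemidef.diagonal fun k => ?_
    have hk : hA.1.eigenvalues k ≤ A.trace.re := by
      rw [hA.1.trace_eq_sum_eigenvalues]
      simpa using Finset.single_le_sum (f := hA.1.eigenvalues)
        (fun i _ => hA.eigenvalues_nonneg i) (Finset.mem_univ k)
    simpa using hk
  have hU : (hA.1.eigenvectorUnitary : Matrix n n ℂ) * (hA.1.eigenvectorUnitary : Matrix n n ℂ)ᴴ
      = 1 := Unitary.coe_mul_star_self hA.1.eigenvectorUnitary
  convert hD.mul_mul_conjTranspose_same (hA.1.eigenvectorUnitary : Matrix n n ℂ) using 1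
  have hsplit : (Matrix.diagonal fun k => ((A.trace.re - hA.1.eigenvalues k : ℝ) : ℂ))
      = (A.trace.re : ℂ) • (1 : Matrix n n ℂ)
        - Matrix.diagonal (RCLike.ofReal ∘ hA.1.eigenvalues) := by
    rw [← Matrix.diagonal_one, ← Matrix.diagonal_smul, Matrix.diagonal_sub]
    congr 1; ext k; simp
  rw [hsplit, Matrix.mul_sub, Matrix.sub_mul, Matrix.mul_smul, Matrix.mul_one, Matrix.smul_mul, hU]
  congr 1
  conv_lhs => rw [hA.1.spectral_theorem]
  rw [Unitary.conjStarAlgAut_apply]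
  rfl

lemma Matrix.PosSemidef.trace_mul_re_le {n : Type*} [Fintype n] {A B : Matrix n n ℂ}
    (hA : A.PosSemidef) (hB : B.PosSemidef) :
    (A * B).trace.re ≤ B.trace.re * A.trace.re := by
  have h := hA.trace_mul_re_nonneg hB.trace_smul_one_sub
  simpa [Matrix.mul_sub] using h

/-- Operator Jensen inequality for the square: `(∑ c i • M i)² ≤ ∑ (c i)² • M i`. -/
lemma IsPOVM.posSemidef_sum_sq_sub {n ι : Type*} [Fintype n] [Fintype ι] [DecidableEq n]
    {M : ι → Matrix n n ℂ} (hM : IsPOVM M) (c : ι → ℝ) :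
    (∑ i, ((c i ^ 2 : ℝ) : ℂ) • M i
      - (∑ i, (c i : ℂ) • M i) * ∑ i, (c i : ℂ) • M i).PosSemidef := by
  set C := ∑ i, (c i : ℂ) • M i with hCdef
  have hC : Cᴴ = C := by
    simp [hCdef, Matrix.conjTranspose_sum, fun i => (hM.1 i).1.eq]
  have key : ∑ i, ((c i ^ 2 : ℝ) : ℂ) • M i - C * C
      = ∑ i, ((c i : ℂ) • (1 : Matrix n n ℂ) - C)ᴴ * M i * ((c i : ℂ) • (1 : Matrix n n ℂ) - C) := by
    have hexp : ∀ i, ((c i : ℂ) • (1 : Matrix n n ℂ) - C)ᴴ * M i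
        * ((c i : ℂ) • (1 : Matrix n n ℂ) - C)
        = ((c i ^ 2 : ℝ) : ℂ) • M i - ((c i : ℂ) • M i) * C - C * ((c i : ℂ) • M i)
          + C * M i * C := by
      intro i
      simp only [Matrix.conjTranspose_sub, Matrix.conjTranspose_smul, Matrix.conjTranspose_one, hC,
        Complex.star_def, Complex.conj_ofReal, Matrix.sub_mul, Matrix.mul_sub, Matrix.smul_mul,
        Matrix.mul_smul, Matrix.one_mul, Matrix.mul_one, smul_sub, smul_smul, Complex.ofReal_mul, sq]
      abel
    simp only [hexp, Finset.sum_add_distrib, Finset.sum_sub_distrib, ← Finset.sum_mul,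
      ← Finset.mul_sum, hM.2, ← hCdef, Matrix.mul_one]
    abel
  rw [key]
  exact Matrix.posSemidef_sum _ fun i _ => (hM.1 i).conjTranspose_mul_mul_same _

lemma IsPOVM.two_mul_sum_sub_le {n ι : Type*} [Fintype n] [Fintype ι] [DecidableEq n]
    {M : ι → Matrix n n ℂ} (hM : IsPOVM M) {P : Matrix n n ℂ} (hP : P.PosSemidef)
    {l : n → ℝ} (hl : ∀ k, 0 ≤ l k) {t : ℝ} (ht : 0 < t) (c : ι → ℝ) :
    2 * ∑ i, c i * (M i * P).trace.re
      - ∑ i, c i ^ 2 * (P.trace.re * (M i * Matrix.diagonal fun k => (l k : ℂ)).trace.re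
          + t * (M i * P).trace.re)
      ≤ ∑ k, (P k k).re / (l k + t) := by
  set D : Matrix n n ℂ := Matrix.diagonal fun k => (l k : ℂ) with hD
  set C := ∑ i, (c i : ℂ) • M i with hCdef
  have hC : Cᴴ = C := by
    simp [hCdef, Matrix.conjTranspose_sum, fun i => (hM.1 i).1.eq]
  set R : Matrix n n ℂ := D + (t : ℂ) • 1 with hR
  set Ri : Matrix n n ℂ := Matrix.diagonal fun k => ((1 / (l k + t) : ℝ) : ℂ) with hRi
  have hpos : ∀ k, 0 < l k + t := fun k => add_pos_of_nonneg_of_pos (hl k) ht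
  have hRdiag : R = Matrix.diagonal fun k => ((l k + t : ℝ) : ℂ) := by
    rw [hR, hD, ← Matrix.diagonal_one, ← Matrix.diagonal_smul, Matrix.diagonal_add]
    congr 1; ext k; simp
  have hRh : Rᴴ = R := by
    rw [hRdiag, Matrix.diagonal_conjTranspose]; congr 1; ext k; simp
  have hRRi : R * Ri = 1 := by
    rw [hRdiag, hRi, Matrix.diagonal_mul_diagonal, ← Matrix.diagonal_one]
    congr 1; ext k
    rw [← Complex.ofReal_mul, mul_one_div_cancel (hpos k).ne', Complex.ofReal_one]
  have hRiR : Ri * R = 1 := mul_eq_one_comm.1 hRRi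
  have hDpsd : D.PosSemidef := Matrix.PosSemidef.diagonal fun k => by simpa using hl k
  have hRipsd : Ri.PosSemidef := Matrix.PosSemidef.diagonal fun k => by
    simpa only [Pi.zero_apply, Complex.zero_le_real] using (one_div_pos.2 (hpos k)).le
  have h1 : 0 ≤ ((Ri - C - C + C * R * C) * P).trace.re := by
    refine Matrix.PosSemidef.trace_mul_re_nonneg ?_ hP
    convert hRipsd.conjTranspose_mul_mul_same (R * C - 1) using 1
    have h : (C * R - 1) * Ri = C - Ri := by
      rw [Matrix.sub_mul, Matrix.mul_assoc, hRRi, Matrix.mul_one, Matrix.one_mul]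
    rw [Matrix.conjTranspose_sub, Matrix.conjTranspose_mul, hC, hRh, Matrix.conjTranspose_one, h,
      Matrix.sub_mul, Matrix.mul_sub, Matrix.mul_sub, ← Matrix.mul_assoc Ri, hRiR]
    simp only [Matrix.mul_one, Matrix.one_mul, Matrix.mul_assoc]
    abel
  have h2 := (hM.posSemidef_sum_sq_sub c).trace_mul_re_nonneg hP
  have h3 := (hM.posSemidef_sum_sq_sub c).trace_mul_re_nonneg hDpsd
  have h4 : (C * D * C * P).trace.re ≤ P.trace.re * (C * C * D).trace.re := by
    have h := (hDpsd.conjTranspose_mul_mul_same C).trace_mul_re_le hP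
    rwa [hC, Matrix.trace_mul_comm (C * D), ← Matrix.mul_assoc C C D] at h
  have hsq : ∀ X : Matrix n n ℂ, ((∑ i, ((c i ^ 2 : ℝ) : ℂ) • M i) * X).trace.re
      = ∑ i, c i ^ 2 * (M i * X).trace.re := by
    intro X
    simp only [Finset.sum_mul, Matrix.trace_sum, Matrix.smul_mul, Matrix.trace_smul, smul_eq_mul,
      Complex.re_sum, Complex.re_ofReal_mul]
  have hCP : (C * P).trace.re = ∑ i, c i * (M i * P).trace.re := by
    simp only [hCdef, Finset.sum_mul, Matrix.trace_sum, Matrix.smul_mul, Matrix.trace_smul,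
      smul_eq_mul, Complex.re_sum, Complex.re_ofReal_mul]
  have hRiP : (Ri * P).trace.re = ∑ k, (P k k).re / (l k + t) := by
    simp only [hRi, Matrix.trace, Matrix.diag_apply, Matrix.diagonal_mul, Complex.re_sum,
      Complex.re_ofReal_mul]
    exact Finset.sum_congr rfl fun k _ => by ring
  have hCRC : (C * R * C * P).trace.re = (C * D * C * P).trace.re + t * (C * C * P).trace.re := by
    rw [hR]
    simp only [Matrix.mul_add, Matrix.add_mul, Matrix.mul_smul, Matrix.smul_mul, Matrix.mul_one,
      Matrix.trace_add, Matrix.trace_smul, smul_eq_mul, Complex.add_re, Complex.re_ofReal_mul]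
  simp only [Matrix.add_mul, Matrix.sub_mul, Matrix.trace_add, Matrix.trace_sub, Complex.add_re,
    Complex.sub_re, hRiP, hCP, hCRC] at h1
  rw [Matrix.sub_mul, Matrix.trace_sub, Complex.sub_re, hsq] at h2 h3
  have hq : 0 ≤ P.trace.re := (Complex.le_def.1 hP.trace_nonneg).1
  have hsum : ∑ i, c i ^ 2 * (P.trace.re * (M i * D).trace.re + t * (M i * P).trace.re)
      = P.trace.re * ∑ i, c i ^ 2 * (M i * D).trace.re
        + t * ∑ i, c i ^ 2 * (M i * P).trace.re := by
    rw [Finset.mul_sum, Finset.mul_sum, ← Finset.sum_add_distrib]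
    exact Finset.sum_congr rfl fun i _ => by ring
  rw [hsum]
  nlinarith [mul_nonneg hq h3, mul_nonneg ht.le h2]

lemma IsPOVM.sum_sq_div_le {n ι : Type*} [Fintype n] [Fintype ι] [DecidableEq n]
    {M : ι → Matrix n n ℂ} (hM : IsPOVM M) {P : Matrix n n ℂ} (hP : P.PosSemidef)
    {l : n → ℝ} (hl : ∀ k, 0 ≤ l k) {t : ℝ} (ht : 0 < t) :
    ∑ i, (M i * P).trace.re ^ 2 /
        (P.trace.re * (M i * Matrix.diagonal fun k => (l k : ℂ)).trace.re
          + t * (M i * P).trace.re)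
      ≤ ∑ k, (P k k).re / (l k + t) := by
  refine le_trans (le_of_eq ?_) (hM.two_mul_sum_sub_le hP hl ht fun i => (M i * P).trace.re /
    (P.trace.re * (M i * Matrix.diagonal fun k => (l k : ℂ)).trace.re + t * (M i * P).trace.re))
  rw [Finset.mul_sum, ← Finset.sum_sub_distrib]
  refine Finset.sum_congr rfl fun i _ => ?_
  generalize P.trace.re * (M i * Matrix.diagonal fun k => (l k : ℂ)).trace.re
    + t * (M i * P).trace.re = d
  rcases eq_or_ne d 0 with rfl | hd
  · simp
  · field_simp; ring

/-- If `∑ p²/(d + t p) ≤ ∑ w/(l + t)` for all `t > 0`, then the logarithms compare the other way. -/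
lemma sum_mul_log_le_of_resolvent_le {ι n : Type*} [Fintype ι] [Fintype n]
    {p d : ι → ℝ} {w l : n → ℝ} (hp : ∀ i, 0 ≤ p i)
    (hd : ∀ i, p i ≠ 0 → 0 < d i) (hw : ∀ k, w k ≠ 0 → 0 < l k)
    (hsum : ∑ i, p i = ∑ k, w k)
    (h : ∀ t : ℝ, 0 < t → ∑ i, p i ^ 2 / (d i + t * p i) ≤ ∑ k, w k / (l k + t)) :
    ∑ k, w k * Real.log (l k) ≤ ∑ i, p i * Real.log (d i / p i) := by
  have hx : ∀ i, p i ≠ 0 → 0 < d i / p i := fun i hi =>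
    div_pos (hd i hi) (lt_of_le_of_ne (hp i) hi.symm)
  set G : ℝ → ℝ := fun t => ∑ k, w k * Real.log (l k + t)
    - ∑ i, p i * Real.log (d i / p i + t) with hG
  have hderiv : ∀ t : ℝ, 0 ≤ t → HasDerivAt G
      (∑ k, w k / (l k + t) - ∑ i, p i / (d i / p i + t)) t := by
    intro t ht
    refine HasDerivAt.sub (HasDerivAt.fun_sum fun k _ => ?_) (HasDerivAt.fun_sum fun i _ => ?_)
    · rcases eq_or_ne (w k) 0 with h0 | h0
      · simpa [h0] using hasDerivAt_const t (0 : ℝ)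
      · have := (((hasDerivAt_id t).const_add (l k)).log
          (add_pos_of_pos_of_nonneg (hw k h0) ht).ne').const_mul (w k)
        simpa [div_eq_mul_inv] using this
    · rcases eq_or_ne (p i) 0 with h0 | h0
      · simpa [h0] using hasDerivAt_const t (0 : ℝ)
      · have := (((hasDerivAt_id t).const_add (d i / p i)).log
          (add_pos_of_pos_of_nonneg (hx i h0) ht).ne').const_mul (p i)
        simpa [div_eq_mul_inv] using this
  have hmono : MonotoneOn G (Set.Ici 0) := by
    refine monotoneOn_of_deriv_nonneg (convex_Ici 0)
      (fun t ht => (hderiv t ht).continuousAt.continuousWithinAt)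
      (fun t ht => (hderiv t (interior_subset ht)).differentiableAt.differentiableWithinAt) ?_
    intro t ht
    rw [interior_Ici] at ht
    rw [(hderiv t (le_of_lt ht)).deriv, sub_nonneg]
    refine le_trans (le_of_eq (Finset.sum_congr rfl fun i _ => ?_)) (h t ht)
    rcases eq_or_ne (p i) 0 with h0 | h0
    · simp [h0]
    · rw [div_add' _ _ _ h0, div_div_eq_mul_div, sq]
  have hlog : ∀ x : ℝ, Filter.Tendsto (fun t : ℝ => Real.log (x + t) - Real.log t)
      Filter.atTop (nhds 0) := fun x => by
    simpa [add_comm] using Real.tendsto_log_comp_add_sub_log x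
  have hlim : Filter.Tendsto G Filter.atTop (nhds 0) := by
    have h1 : Filter.Tendsto (fun t : ℝ => ∑ k, w k * (Real.log (l k + t) - Real.log t)
        - ∑ i, p i * (Real.log (d i / p i + t) - Real.log t)) Filter.atTop (nhds 0) := by
      have := (tendsto_finsetSum Finset.univ fun k _ => (hlog (l k)).const_mul (w k)).sub
        (tendsto_finsetSum Finset.univ fun i _ => (hlog (d i / p i)).const_mul (p i))
      simpa using this
    refine h1.congr fun t => ?_
    simp only [hG, mul_sub, Finset.sum_sub_distrib, ← Finset.sum_mul, hsum]
    ring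
  have h0 : G 0 ≤ 0 := ge_of_tendsto hlim <| by
    filter_upwards [Filter.eventually_ge_atTop 0] with t ht
    exact hmono Set.self_mem_Ici ht ht
  simpa [hG] using h0

lemma trace_mul_ptraceR {a b : Type*} [Fintype a] [Fintype b] [DecidableEq b]
    (M : Matrix a a ℂ) (Z : Matrix (a × b) (a × b) ℂ) :
    (M * ptraceR Z).trace = ((M ⊗ₖ (1 : Matrix b b ℂ)) * Z).trace := by
  simp only [Matrix.trace, Matrix.diag_apply, Matrix.mul_apply, ptraceR, Fintype.sum_prod_type,
    Matrix.kroneckerMap_apply, Matrix.one_apply, mul_ite, mul_one, mul_zero, ite_mul, zero_mul,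
    Finset.sum_ite_eq, Finset.mem_univ, if_true, Finset.mul_sum]
  exact Finset.sum_congr rfl fun i _ => Finset.sum_comm

lemma Matrix.PosSemidef.ptraceR {a b : Type*} [Fintype a] [Fintype b]
    {Z : Matrix (a × b) (a × b) ℂ} (hZ : Z.PosSemidef) : (ptraceR Z).PosSemidef := by
  have h : _root_.ptraceR Z = ∑ k, Z.submatrix (fun i => (i, k)) (fun i => (i, k)) := by
    ext i j
    simp [_root_.ptraceR, Matrix.sum_apply]
  rw [h]
  exact Matrix.posSemidef_sum _ fun k _ => hZ.submatrix _

/-- The unnormalized state of `A` conditioned on an outcome of a measurement on `B`. -/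
lemma exists_posSemidef_trace_mul_eq {a b : Type*} [Fintype a] [Fintype b] [DecidableEq a]
    [DecidableEq b] {ρ : Matrix (a × b) (a × b) ℂ} (hρ : ρ.PosSemidef) {N : Matrix b b ℂ}
    (hN : N.PosSemidef) :
    ∃ P : Matrix a a ℂ, P.PosSemidef ∧ ∀ M, (M * P).trace = ((M ⊗ₖ N) * ρ).trace := by
  obtain ⟨B, rfl⟩ := hN.exists_conjTranspose_mul_self
  refine ⟨_, (hρ.mul_mul_conjTranspose_same ((1 : Matrix a a ℂ) ⊗ₖ B)).ptraceR, fun M => ?_⟩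
  rw [trace_mul_ptraceR, ← Matrix.mul_assoc, Matrix.trace_mul_comm, ← Matrix.mul_assoc,
    ← Matrix.mul_assoc, Matrix.conjTranspose_kronecker, Matrix.conjTranspose_one,
    ← Matrix.mul_kronecker_mul, ← Matrix.mul_kronecker_mul, Matrix.one_mul, Matrix.mul_one,
    Matrix.mul_one]

lemma cMutualInfo_eq_sum {ι κ : Type*} [Fintype ι] [Fintype κ] (p : ι → κ → ℝ)
    (hp : ∀ i s, 0 ≤ p i s) :
    cMutualInfo p
      = -(∑ s, ∑ i, p i s * Real.log ((∑ i, p i s) * (∑ s, p i s) / p i s)) / Real.log 2 := by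
  have hterm : ∀ s i, p i s * Real.log ((∑ i, p i s) * (∑ s, p i s) / p i s)
      = p i s * Real.log (∑ i, p i s) + p i s * Real.log (∑ s, p i s)
        - p i s * Real.log (p i s) := by
    intro s i
    rcases eq_or_ne (p i s) 0 with h0 | h0
    · simp [h0]
    · have hpos : 0 < p i s := lt_of_le_of_ne (hp i s) h0.symm
      have h1 : 0 < ∑ i, p i s := hpos.trans_le
        (Finset.single_le_sum (f := fun i => p i s) (fun i _ => hp i s) (Finset.mem_univ i))
      have h2 : 0 < ∑ s, p i s := hpos.trans_le
        (Finset.single_le_sum (f := fun s => p i s) (fun s _ => hp i s) (Finset.mem_univ s))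
      rw [Real.log_div (mul_pos h1 h2).ne' h0, Real.log_mul h1.ne' h2.ne']
      ring
  simp only [hterm, Finset.sum_add_distrib, Finset.sum_sub_distrib, ← Finset.sum_mul]
  rw [Finset.sum_comm (f := fun s i => p i s * Real.log (∑ s, p i s)),
    Finset.sum_comm (f := fun s i => p i s * Real.log (p i s))]
  simp only [cMutualInfo, shannon, Real.logb, ← mul_div_assoc, ← Finset.sum_div,
    Fintype.sum_prod_type, ← Finset.sum_mul]
  ring

/-- Holevo-type bound for an ensemble `P` of unnormalized states whose sum is diagonal. -/
lemma IsPOVM.sum_mul_log_le {n ι κ : Type*} [Fintype n] [Fintype ι] [Fintype κ] [DecidableEq n]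
    {M : ι → Matrix n n ℂ} (hM : IsPOVM M) {P : κ → Matrix n n ℂ} (hP : ∀ s, (P s).PosSemidef)
    {l : n → ℝ} (hsum : ∑ s, P s = Matrix.diagonal fun k => (l k : ℂ)) {p : ι → κ → ℝ}
    (hp : ∀ i s, p i s = (M i * P s).trace.re) :
    ∑ k, l k * Real.log (l k)
      ≤ ∑ s, ∑ i, p i s * Real.log ((∑ i, p i s) * (∑ s, p i s) / p i s) := by
  have hp0 : ∀ i s, 0 ≤ p i s := fun i s => by
    rw [hp]; exact (hM.1 i).trace_mul_re_nonneg (hP s)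
  have hw0 : ∀ k s, 0 ≤ (P s k k).re := fun k s => (Complex.le_def.1 (hP s).diag_nonneg).1
  have hlk : ∀ k, l k = ∑ s, (P s k k).re := fun k => by
    have := congrArg (fun A : Matrix n n ℂ => (A k k).re) hsum
    simpa [Matrix.sum_apply] using this.symm
  have hl : ∀ k, 0 ≤ l k := fun k => by
    rw [hlk]; exact Finset.sum_nonneg fun s _ => hw0 k s
  have hr : ∀ i, (M i * Matrix.diagonal fun k => (l k : ℂ)).trace.re = ∑ s, p i s := fun i => by
    rw [← hsum, Finset.mul_sum, Matrix.trace_sum, Complex.re_sum]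
    exact Finset.sum_congr rfl fun s _ => (hp i s).symm
  have hq : ∀ s, (P s).trace.re = ∑ i, p i s := fun s => by
    simp only [hp]
    rw [← Complex.re_sum, ← Matrix.trace_sum, ← Finset.sum_mul, hM.2, Matrix.one_mul]
  have key : ∀ s, ∑ k, (P s k k).re * Real.log (l k)
      ≤ ∑ i, p i s * Real.log ((∑ i, p i s) * (∑ s, p i s) / p i s) := by
    intro s
    refine sum_mul_log_le_of_resolvent_le (hp0 · s) ?_ ?_ ?_ ?_
    · intro i hi
      have hpos : 0 < p i s := lt_of_le_of_ne (hp0 i s) hi.symm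
      exact mul_pos
        (hpos.trans_le (Finset.single_le_sum (f := fun i => p i s) (fun i _ => hp0 i s)
          (Finset.mem_univ i)))
        (hpos.trans_le (Finset.single_le_sum (f := fun s => p i s) (fun s _ => hp0 i s)
          (Finset.mem_univ s)))
    · intro k hk
      rw [hlk]
      exact (lt_of_le_of_ne (hw0 k s) hk.symm).trans_le
        (Finset.single_le_sum (f := fun s => (P s k k).re) (fun s _ => hw0 k s)
          (Finset.mem_univ s))
    · rw [← hq]
      simp [Matrix.trace, Complex.re_sum]
    · intro t ht
      have h := hM.sum_sq_div_le (hP s) hl ht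
      simpa only [hr, hq, ← hp] using h
  refine le_trans (le_of_eq ?_) (Finset.sum_le_sum fun s _ => key s)
  rw [Finset.sum_comm]
  exact Finset.sum_congr rfl fun k _ => by rw [← Finset.sum_mul, ← hlk]

/-- Holevo-type bound: classical mutual information of local
measurement outcomes is at most the von Neumann entropy of the reduced state ρ_A. -/
theorem stmt0 {a b ι κ : Type*} [Fintype a] [Fintype b] [Fintype ι] [Fintype κ]
    [DecidableEq a] [DecidableEq b]
    (ρ : Matrix (a × b) (a × b) ℂ) (hρ : IsDensityMatrix ρ)
    (M : ι → Matrix a a ℂ) (hM : IsPOVM M)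
    (N : κ → Matrix b b ℂ) (hN : IsPOVM N) :
    cMutualInfo (measProb ρ M N) ≤ vnEntropy (ptraceR ρ) := by
  choose P hP hPtr using fun s => exists_posSemidef_trace_mul_eq hρ.1 (hN.1 s)
  have hPsum : ∑ s, P s = ptraceR ρ := by
    refine Matrix.ext_iff_trace_mul_left.2 fun X => ?_
    rw [trace_mul_ptraceR, ← hN.2, Finset.mul_sum, Matrix.trace_sum]
    simp only [hPtr]
    rw [← Matrix.trace_sum, ← Finset.sum_mul]
    congr 2
    ext x y
    simp [Matrix.sum_apply, Finset.mul_sum]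
  have hA : (ptraceR ρ).IsHermitian := hρ.1.ptraceR.1
  set U := (hA.eigenvectorUnitary : Matrix a a ℂ)
  have hUU : U * Uᴴ = 1 := Unitary.coe_mul_star_self hA.eigenvectorUnitary
  have hUU' : Uᴴ * U = 1 := mul_eq_one_comm.1 hUU
  have hM' : IsPOVM fun i => Uᴴ * M i * U := by
    refine ⟨fun i => (hM.1 i).conjTranspose_mul_mul_same U, ?_⟩
    rw [← Finset.sum_mul, ← Finset.mul_sum, hM.2, Matrix.mul_one, hUU']
  have hsum : ∑ s, Uᴴ * P s * U = Matrix.diagonal fun k => (hA.eigenvalues k : ℂ) := by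
    rw [← Finset.sum_mul, ← Finset.mul_sum, hPsum]
    have h : ptraceR ρ = U * (Matrix.diagonal fun k => (hA.eigenvalues k : ℂ)) * Uᴴ := by
      conv_lhs => rw [hA.spectral_theorem, Unitary.conjStarAlgAut_apply]
      rfl
    generalize Matrix.diagonal (fun k => (hA.eigenvalues k : ℂ)) = D at h
    rw [h]
    simp only [Matrix.mul_assoc, hUU', Matrix.mul_one]
    rw [← Matrix.mul_assoc, hUU', Matrix.one_mul]
  have hp : ∀ i s, measProb ρ M N i s = ((Uᴴ * M i * U) * (Uᴴ * P s * U)).trace.re := by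
    intro i s
    have h : (Uᴴ * M i * U) * (Uᴴ * P s * U) = Uᴴ * (M i * P s) * U := by
      simp only [Matrix.mul_assoc]
      rw [← Matrix.mul_assoc U, hUU, Matrix.one_mul]
    rw [h, Matrix.trace_mul_comm, ← Matrix.mul_assoc, hUU, Matrix.one_mul, hPtr]
    rfl
  have hp0 : ∀ i s, 0 ≤ measProb ρ M N i s := fun i s => by
    rw [hp]
    exact (hM'.1 i).trace_mul_re_nonneg ((hP s).conjTranspose_mul_mul_same U)
  have key := hM'.sum_mul_log_le (fun s => (hP s).conjTranspose_mul_mul_same U) hsum hp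
  rw [cMutualInfo_eq_sum _ hp0, vnEntropy, dif_pos hA, shannon]
  simp only [Real.logb, ← mul_div_assoc, ← Finset.sum_div]
  rw [← neg_div]
  exact div_le_div_of_nonneg_right (neg_le_neg key) (Real.log_nonneg one_le_two)
end
end

section
/- Quantum mutual information is nonincreasing under local quantum channels: if Φ_A and Φ_B are completely positive trace-preserving maps on systems A and B respectively, and σ_AB = (Φ_A ⊗ Φ_B)(ρ_AB), then S(A:B)_σ ≤ S(A:B)_ρ. -/
open Matrix BigOperators
open scoped Kronecker Classical ComplexOrder

noncomputable section

/-- A family of Kraus operators (from space `n` to space `m`) for a CPTP map: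
they satisfy the trace-preservation condition ∑ Kᵢ† Kᵢ = 1. -/
def IsKrausFamily {n m ι : Type*} [Fintype n] [Fintype m] [Fintype ι] [DecidableEq n]
    (K : ι → Matrix m n ℂ) : Prop :=
  ∑ i, (K i).conjTranspose * K i = 1

section Analytic

open Filter Topology

theorem tendsto_log_add_mul_sub_log {p : ℝ} (hp : 0 < p) (q : ℝ) :
    Tendsto (fun s : ℝ => Real.log (q + s * p) - Real.log s) atTop (𝓝 (Real.log p)) := by
  have h1 : Tendsto (fun s : ℝ => q / s + p) atTop (𝓝 (0 + p)) :=
    (tendsto_const_nhds.div_atTop tendsto_id).add tendsto_const_nhds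
  rw [zero_add] at h1
  refine (h1.log hp.ne').congr' ?_
  filter_upwards [eventually_gt_atTop 0, h1.eventually (lt_mem_nhds hp)] with s hs hpos
  have h2 : q + s * p = s * (q / s + p) := by field_simp
  rw [h2, Real.log_mul hs.ne' hpos.ne']
  ring

variable {K L : Type*} [Fintype K] [Fintype L]

theorem tendsto_sum_mul_log_sub_log (c p q : K → ℝ) (hp : ∀ k, c k ≠ 0 → 0 < p k) :
    Tendsto (fun s : ℝ => ∑ k, c k * Real.log (q k + s * p k) - (∑ k, c k) * Real.log s) atTop
      (𝓝 (∑ k, c k * Real.log (p k))) := by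
  simp_rw [Finset.sum_mul, ← Finset.sum_sub_distrib, ← mul_sub]
  refine tendsto_finsetSum _ fun k _ => ?_
  by_cases hc : c k = 0
  · simp [hc]
  · exact (tendsto_log_add_mul_sub_log (hp k hc) (q k)).const_mul _

theorem hasDerivAt_sum_mul_log (c p q : K → ℝ) (hp : ∀ k, c k ≠ 0 → 0 < p k)
    (hq : ∀ k, c k ≠ 0 → 0 < q k) {s : ℝ} (hs : 0 ≤ s) :
    HasDerivAt (fun s : ℝ => ∑ k, c k * Real.log (q k + s * p k))
      (∑ k, c k * p k / (q k + s * p k)) s := by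
  refine HasDerivAt.fun_sum fun k _ => ?_
  by_cases hc : c k = 0
  · simpa [hc] using hasDerivAt_const s (0 : ℝ)
  · have hpos : 0 < q k + s * p k := by
      have := hp k hc
      have := hq k hc
      positivity
    have h1 : HasDerivAt (fun s : ℝ => q k + s * p k) (p k) s := by
      simpa using ((hasDerivAt_id s).mul_const (p k)).const_add (q k)
    simpa [mul_div_assoc] using (h1.log hpos.ne').const_mul (c k)

/-- Comparing the resolvents `p / (q + s p)` for all `s > 0` compares `log p - log q`. -/
theorem sum_mul_log_sub_log_le (c p q : K → ℝ) (c' p' q' : L → ℝ)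
    (hp : ∀ k, c k ≠ 0 → 0 < p k) (hq : ∀ k, c k ≠ 0 → 0 < q k)
    (hp' : ∀ k, c' k ≠ 0 → 0 < p' k) (hq' : ∀ k, c' k ≠ 0 → 0 < q' k)
    (hc : ∑ k, c k = ∑ k, c' k)
    (h : ∀ s : ℝ, 0 < s →
      ∑ k, c' k * p' k / (q' k + s * p' k) ≤ ∑ k, c k * p k / (q k + s * p k)) :
    ∑ k, c' k * (Real.log (p' k) - Real.log (q' k)) ≤
      ∑ k, c k * (Real.log (p k) - Real.log (q k)) := by
  set f : ℝ → ℝ := fun s => ∑ k, c k * Real.log (q k + s * p k) -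
    ∑ k, c' k * Real.log (q' k + s * p' k) with hf
  have hd : ∀ s, 0 ≤ s → HasDerivAt f (∑ k, c k * p k / (q k + s * p k) -
      ∑ k, c' k * p' k / (q' k + s * p' k)) s := fun s hs =>
    (hasDerivAt_sum_mul_log c p q hp hq hs).sub (hasDerivAt_sum_mul_log c' p' q' hp' hq' hs)
  have hmono : MonotoneOn f (Set.Ici 0) := by
    refine monotoneOn_of_deriv_nonneg (convex_Ici 0)
      (fun s hs => (hd s hs).continuousAt.continuousWithinAt) (fun s hs => ?_) (fun s hs => ?_)
    · rw [interior_Ici] at hs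
      exact (hd s (le_of_lt hs)).differentiableAt.differentiableWithinAt
    · rw [interior_Ici] at hs
      rw [(hd s (le_of_lt hs)).deriv]
      exact sub_nonneg.2 (h s hs)
  have hlim : Tendsto f atTop
      (𝓝 (∑ k, c k * Real.log (p k) - ∑ k, c' k * Real.log (p' k))) := by
    refine ((tendsto_sum_mul_log_sub_log c p q hp).sub
      (tendsto_sum_mul_log_sub_log c' p' q' hp')).congr fun s => ?_
    rw [hf, hc]
    ring
  have h0 := ge_of_tendsto hlim
    ((eventually_ge_atTop 0).mono fun s hs => hmono Set.self_mem_Ici hs hs)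
  simp only [hf, zero_mul, add_zero] at h0
  simp only [mul_sub, Finset.sum_sub_distrib]
  linarith

end Analytic

section Channel

variable {m n ι : Type*} [Fintype m] [Fintype ι]

/-- The dual map `Y ↦ ∑ᵢ Mᵢ† Y Mᵢ`. -/
def krausDual (M : ι → Matrix m n ℂ) (Y : Matrix m m ℂ) : Matrix n n ℂ :=
  ∑ i, (M i)ᴴ * Y * M i

theorem krausDual_conjTranspose (M : ι → Matrix m n ℂ) (Y : Matrix m m ℂ) :
    krausDual M Yᴴ = (krausDual M Y)ᴴ := by
  simp [krausDual, Matrix.conjTranspose_sum, Matrix.mul_assoc]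

variable [Fintype n]

/-- The map `ρ ↦ ∑ᵢ Mᵢ ρ Mᵢ†`. -/
def krausMap (M : ι → Matrix m n ℂ) (ρ : Matrix n n ℂ) : Matrix m m ℂ :=
  ∑ i, M i * ρ * (M i)ᴴ

/-- The quadratic functional whose supremum over `X` is the quasi-entropy of the pair `(ρ, τ)`
for the function `x ↦ 1 / (x + s)`. -/
def quadForm (s : ℝ) (ρ τ X : Matrix n n ℂ) : ℝ :=
  2 * (X * ρ).trace.re - (Xᴴ * τ * X).trace.re - s * (X * ρ * Xᴴ).trace.re

theorem krausMap_posSemidef (M : ι → Matrix m n ℂ) {ρ : Matrix n n ℂ} (hρ : ρ.PosSemidef) :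
    (krausMap M ρ).PosSemidef :=
  Matrix.posSemidef_sum _ fun i _ => hρ.mul_mul_conjTranspose_same (M i)

theorem trace_mul_krausMap (M : ι → Matrix m n ℂ) (ρ : Matrix n n ℂ) (Y : Matrix m m ℂ) :
    (Y * krausMap M ρ).trace = (krausDual M Y * ρ).trace := by
  simp only [krausMap, krausDual, Finset.mul_sum, Finset.sum_mul, Matrix.trace_sum]
  refine Finset.sum_congr rfl fun i _ => ?_
  rw [← Matrix.mul_assoc, Matrix.trace_mul_comm]
  simp only [Matrix.mul_assoc]

variable [DecidableEq n]

theorem trace_krausMap {M : ι → Matrix m n ℂ} (hM : IsKrausFamily M) (ρ : Matrix n n ℂ) :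
    (krausMap M ρ).trace = ρ.trace := by
  classical
  have h := trace_mul_krausMap M ρ 1
  have h1 : krausDual M 1 = 1 := by
    simpa [krausDual, IsKrausFamily] using hM
  simpa [h1] using h

/-- The Kadison–Schwarz inequality, tested against a positive semidefinite matrix. -/
theorem trace_krausDual_schwarz {M : ι → Matrix m n ℂ} (hM : IsKrausFamily M)
    {τ : Matrix n n ℂ} (hτ : τ.PosSemidef) (Y : Matrix m m ℂ) :
    ((krausDual M Y)ᴴ * τ * krausDual M Y).trace.re ≤ (Yᴴ * krausMap M τ * Y).trace.re := by
  set X := krausDual M Y with hX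
  have hpos : 0 ≤ (∑ i, (Yᴴ * M i - M i * Xᴴ) * τ * (Yᴴ * M i - M i * Xᴴ)ᴴ).trace :=
    (Matrix.posSemidef_sum _ fun i _ =>
      hτ.mul_mul_conjTranspose_same (Yᴴ * M i - M i * Xᴴ)).trace_nonneg
  have e : (∑ i, (Yᴴ * M i - M i * Xᴴ) * τ * (Yᴴ * M i - M i * Xᴴ)ᴴ).trace =
      (Yᴴ * krausMap M τ * Y).trace - (Xᴴ * τ * X).trace := by
    have e1 : ∀ i, ((Yᴴ * M i - M i * Xᴴ) * τ * (Yᴴ * M i - M i * Xᴴ)ᴴ).trace =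
        (Yᴴ * (M i * τ * (M i)ᴴ) * Y).trace - (τ * X * ((M i)ᴴ * Yᴴ * M i)).trace
          - (Xᴴ * τ * ((M i)ᴴ * Y * M i)).trace + (Xᴴ * τ * X * ((M i)ᴴ * M i)).trace := by
      intro i
      simp only [Matrix.conjTranspose_sub, Matrix.conjTranspose_mul,
        Matrix.conjTranspose_conjTranspose, Matrix.sub_mul, Matrix.mul_sub, Matrix.trace_sub]
      have a1 : (Yᴴ * M i * τ * (X * (M i)ᴴ)).trace = (τ * X * ((M i)ᴴ * Yᴴ * M i)).trace := by
        rw [Matrix.mul_assoc (Yᴴ * M i), Matrix.trace_mul_comm]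
        simp only [Matrix.mul_assoc]
      have a2 : (M i * Xᴴ * τ * ((M i)ᴴ * Y)).trace = (Xᴴ * τ * ((M i)ᴴ * Y * M i)).trace := by
        rw [Matrix.mul_assoc (M i), Matrix.mul_assoc (M i), Matrix.trace_mul_comm]
        simp only [Matrix.mul_assoc]
      have a3 : (M i * Xᴴ * τ * (X * (M i)ᴴ)).trace = (Xᴴ * τ * X * ((M i)ᴴ * M i)).trace := by
        rw [Matrix.mul_assoc (M i), Matrix.mul_assoc (M i), Matrix.trace_mul_comm]
        simp only [Matrix.mul_assoc]
      rw [a1, a2, a3]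
      simp only [Matrix.mul_assoc]
      ring
    have hM' : ∑ i, (M i)ᴴ * M i = 1 := hM
    have hXs : ∑ i, (M i)ᴴ * Y * M i = X := rfl
    have hXs' : ∑ i, (M i)ᴴ * Yᴴ * M i = Xᴴ := krausDual_conjTranspose M Y
    rw [Matrix.trace_sum]
    simp_rw [e1]
    rw [Finset.sum_add_distrib, Finset.sum_sub_distrib, Finset.sum_sub_distrib]
    simp only [← Matrix.trace_sum, ← Finset.mul_sum, ← Finset.sum_mul, hM', hXs, hXs',
      Matrix.mul_one]
    have a4 : (τ * X * Xᴴ).trace = (Xᴴ * τ * X).trace := by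
      rw [Matrix.trace_mul_comm, Matrix.mul_assoc]
    rw [a4, krausMap]
    ring
  rw [e] at hpos
  have := (Complex.le_def.1 hpos).1
  simp only [Complex.zero_re, Complex.sub_re] at this
  linarith

theorem quadForm_krausMap_le {M : ι → Matrix m n ℂ} (hM : IsKrausFamily M)
    {ρ τ : Matrix n n ℂ} (hρ : ρ.PosSemidef) (hτ : τ.PosSemidef) {s : ℝ} (hs : 0 ≤ s)
    (Y : Matrix m m ℂ) :
    quadForm s (krausMap M ρ) (krausMap M τ) Y ≤ quadForm s ρ τ (krausDual M Y) := by
  have h1 := trace_krausDual_schwarz hM hτ Y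
  have h2 := trace_krausDual_schwarz hM hρ Yᴴ
  rw [krausDual_conjTranspose, Matrix.conjTranspose_conjTranspose,
    Matrix.conjTranspose_conjTranspose] at h2
  have h3 := mul_le_mul_of_nonneg_left h2 hs
  unfold quadForm
  rw [trace_mul_krausMap]
  linarith

end Channel

section Diagonalization

variable {n : Type*} [Fintype n] [DecidableEq n]

theorem quadForm_diagonalized (s : ℝ) {U V : Matrix n n ℂ} (hU : Uᴴ * U = 1) (hV : Vᴴ * V = 1)
    (p q : n → ℝ) (Z : Matrix n n ℂ) :
    quadForm s (U * diagonal (fun i => (p i : ℂ)) * Uᴴ) (V * diagonal (fun i => (q i : ℂ)) * Vᴴ)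
      (V * Z * Uᴴ) = ∑ x : n × n,
        (2 * p x.2 * (Z x.1 x.2 * star ((Vᴴ * U) x.1 x.2)).re
          - Complex.normSq (Z x.1 x.2) * (q x.1 + s * p x.2)) := by
  have cU : ∀ A : Matrix n n ℂ, Uᴴ * (U * A) = A := fun A => by
    rw [← Matrix.mul_assoc, hU, Matrix.one_mul]
  have cV : ∀ A : Matrix n n ℂ, Vᴴ * (V * A) = A := fun A => by
    rw [← Matrix.mul_assoc, hV, Matrix.one_mul]
  have e1 : (V * Z * Uᴴ * (U * diagonal (fun i => (p i : ℂ)) * Uᴴ)).trace =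
      (Z * diagonal (fun i => (p i : ℂ)) * (Vᴴ * U)ᴴ).trace := by
    rw [Matrix.conjTranspose_mul, Matrix.conjTranspose_conjTranspose]
    simp only [Matrix.mul_assoc, cU]
    rw [Matrix.trace_mul_comm]
    simp only [Matrix.mul_assoc]
  have e2 : ((V * Z * Uᴴ)ᴴ * (V * diagonal (fun i => (q i : ℂ)) * Vᴴ) * (V * Z * Uᴴ)).trace =
      (Zᴴ * diagonal (fun i => (q i : ℂ)) * Z).trace := by
    simp only [Matrix.conjTranspose_mul, Matrix.conjTranspose_conjTranspose, Matrix.mul_assoc, cV]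
    rw [Matrix.trace_mul_comm]
    simp only [Matrix.mul_assoc, hU, Matrix.mul_one]
  have e3 : (V * Z * Uᴴ * (U * diagonal (fun i => (p i : ℂ)) * Uᴴ) * (V * Z * Uᴴ)ᴴ).trace =
      (Z * diagonal (fun i => (p i : ℂ)) * Zᴴ).trace := by
    simp only [Matrix.conjTranspose_mul, Matrix.conjTranspose_conjTranspose, Matrix.mul_assoc, cU]
    rw [Matrix.trace_mul_comm]
    simp only [Matrix.mul_assoc, hV, Matrix.mul_one]
  rw [quadForm, e1, e2, e3]
  have f1 : ∀ B C : Matrix n n ℂ, (B * diagonal (fun i => (p i : ℂ)) * Cᴴ).trace.re =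
      ∑ x : n × n, p x.2 * (B x.1 x.2 * star (C x.1 x.2)).re := by
    intro B C
    rw [Fintype.sum_prod_type]
    simp only [Matrix.trace, Matrix.diag, Matrix.mul_apply (N := Cᴴ), Matrix.mul_diagonal,
      Complex.re_sum, Matrix.conjTranspose_apply]
    refine Finset.sum_congr rfl fun i _ => Finset.sum_congr rfl fun j _ => ?_
    rw [mul_right_comm, mul_comm, Complex.re_ofReal_mul]
  have f2 : (Zᴴ * diagonal (fun i => (q i : ℂ)) * Z).trace.re =
      ∑ x : n × n, q x.1 * Complex.normSq (Z x.1 x.2) := by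
    rw [Fintype.sum_prod_type, Finset.sum_comm]
    simp only [Matrix.trace, Matrix.diag, Matrix.mul_apply (N := Z), Matrix.mul_diagonal,
      Complex.re_sum, Matrix.conjTranspose_apply]
    refine Finset.sum_congr rfl fun i _ => Finset.sum_congr rfl fun j _ => ?_
    rw [mul_right_comm, mul_comm, Complex.re_ofReal_mul, mul_comm (star _), Complex.star_def,
      Complex.mul_conj, Complex.ofReal_re]
  rw [f1, f1, f2, Finset.mul_sum, Finset.mul_sum, ← Finset.sum_sub_distrib,
    ← Finset.sum_sub_distrib]
  refine Finset.sum_congr rfl fun x _ => ?_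
  simp only [Complex.star_def, Complex.mul_conj (Z _ _), Complex.ofReal_re]
  ring

theorem two_mul_re_sub_normSq_mul_le (z w : ℂ) {p d : ℝ} (hd : 0 ≤ d) (hpd : d = 0 → p = 0) :
    2 * p * (z * star w).re - Complex.normSq z * d ≤ Complex.normSq w * p * p / d := by
  rcases hd.eq_or_lt with h | h
  · simp [← h, hpd h.symm]
  · rw [le_div_iff₀ h]
    have := Complex.normSq_nonneg (d * z - p * w)
    simp only [Complex.normSq_apply, Complex.star_def, Complex.mul_re, Complex.mul_im,
      Complex.conj_re, Complex.conj_im, Complex.sub_re, Complex.sub_im, Complex.ofReal_re,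
      Complex.ofReal_im] at this ⊢
    nlinarith

variable {U V : Matrix n n ℂ} {p q : n → ℝ} {s : ℝ}

theorem quadForm_le_sum (hU : Uᴴ * U = 1) (hV : Vᴴ * V = 1) (hp : ∀ i, 0 ≤ p i)
    (hq : ∀ i, 0 ≤ q i) (hs : 0 < s) (X : Matrix n n ℂ) :
    quadForm s (U * diagonal (fun i => (p i : ℂ)) * Uᴴ) (V * diagonal (fun i => (q i : ℂ)) * Vᴴ) X
      ≤ ∑ x : n × n, Complex.normSq ((Vᴴ * U) x.1 x.2) * p x.2 * p x.2 / (q x.1 + s * p x.2) := by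
  have hU' : U * Uᴴ = 1 := mul_eq_one_comm.1 hU
  have hV' : V * Vᴴ = 1 := mul_eq_one_comm.1 hV
  have hX : X = V * (Vᴴ * X * U) * Uᴴ := by
    rw [Matrix.mul_assoc, Matrix.mul_assoc, Matrix.mul_assoc, hU', Matrix.mul_one,
      ← Matrix.mul_assoc, hV', Matrix.one_mul]
  rw [hX, quadForm_diagonalized s hU hV]
  refine Finset.sum_le_sum fun x _ => two_mul_re_sub_normSq_mul_le _ _ ?_ fun h => ?_
  · exact add_nonneg (hq _) (mul_nonneg hs.le (hp _))
  · have := hp x.2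
    have h1 := hq x.1
    have h2 := mul_nonneg hs.le this
    have h3 : s * p x.2 = 0 := by linarith
    exact (mul_eq_zero.1 h3).resolve_left hs.ne'

theorem exists_quadForm_eq_sum (hU : Uᴴ * U = 1) (hV : Vᴴ * V = 1) (hp : ∀ i, 0 ≤ p i)
    (hq : ∀ i, 0 ≤ q i) (hs : 0 < s) :
    ∃ X, quadForm s (U * diagonal (fun i => (p i : ℂ)) * Uᴴ)
      (V * diagonal (fun i => (q i : ℂ)) * Vᴴ) X
      = ∑ x : n × n, Complex.normSq ((Vᴴ * U) x.1 x.2) * p x.2 * p x.2 / (q x.1 + s * p x.2) := by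
  refine ⟨V * Matrix.of (fun j i => ((p i / (q j + s * p i) : ℝ) : ℂ) * (Vᴴ * U) j i) * Uᴴ, ?_⟩
  rw [quadForm_diagonalized s hU hV]
  refine Finset.sum_congr rfl fun x _ => ?_
  simp only [Matrix.of_apply]
  rw [mul_assoc (Complex.ofReal _), Complex.star_def, Complex.mul_conj, Complex.re_ofReal_mul,
    Complex.ofReal_re, Complex.normSq_mul, Complex.normSq_ofReal]
  have h1 := hq x.1
  have h2 := mul_nonneg hs.le (hp x.2)
  rcases (add_nonneg h1 h2).eq_or_lt with h | h
  · simp [← h]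
  · field_simp
    ring

theorem Matrix.PosSemidef.exists_eigendecomposition {ρ : Matrix n n ℂ} (hρ : ρ.PosSemidef) :
    ∃ (U : Matrix n n ℂ) (p : n → ℝ), Uᴴ * U = 1 ∧ (∀ i, 0 ≤ p i) ∧
      ρ = U * diagonal (fun i => (p i : ℂ)) * Uᴴ ∧ vnEntropy ρ = shannon p := by
  refine ⟨hρ.1.eigenvectorUnitary, hρ.1.eigenvalues, ?_, hρ.eigenvalues_nonneg, ?_, ?_⟩
  · exact Unitary.coe_star_mul_self hρ.1.eigenvectorUnitary
  · exact hρ.1.spectral_theorem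
  · rw [vnEntropy, dif_pos hρ.1]

end Diagonalization

section Bipartite

variable {a b a' b' ι κ : Type*} [Fintype a] [Fintype b] [Fintype ι] [Fintype κ]

theorem krausMap_kronecker (K : ι → Matrix a' a ℂ) (L : κ → Matrix b' b ℂ)
    (A : Matrix a a ℂ) (B : Matrix b b ℂ) :
    krausMap (fun x : ι × κ => K x.1 ⊗ₖ L x.2) (A ⊗ₖ B) = krausMap K A ⊗ₖ krausMap L B := by
  simp only [krausMap, Fintype.sum_prod_type, Matrix.conjTranspose_kronecker,
    ← Matrix.mul_kronecker_mul]
  ext x y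
  simp only [Matrix.sum_apply, Matrix.kroneckerMap_apply, Finset.sum_mul_sum]

variable [Fintype a'] [Fintype b']

theorem ptraceL_eq_ptraceR_swap (ρ : Matrix (a × b) (a × b) ℂ) :
    ptraceL ρ = ptraceR (ρ.submatrix Prod.swap Prod.swap) := rfl

theorem ptraceR_posSemidef {ρ : Matrix (a × b) (a × b) ℂ} (hρ : ρ.PosSemidef) :
    (ptraceR ρ).PosSemidef := by
  have : ptraceR ρ = ∑ k, ρ.submatrix (fun i => (i, k)) (fun i => (i, k)) := by
    ext i j
    simp [ptraceR, Matrix.sum_apply]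
  rw [this]
  exact Matrix.posSemidef_sum _ fun k _ => hρ.submatrix _

theorem ptraceL_posSemidef {ρ : Matrix (a × b) (a × b) ℂ} (hρ : ρ.PosSemidef) :
    (ptraceL ρ).PosSemidef :=
  ptraceR_posSemidef (hρ.submatrix Prod.swap)

theorem ptraceR_krausMap [DecidableEq b] (K : ι → Matrix a' a ℂ) {L : κ → Matrix b' b ℂ}
    (hL : IsKrausFamily L) (ρ : Matrix (a × b) (a × b) ℂ) :
    ptraceR (krausMap (fun x : ι × κ => K x.1 ⊗ₖ L x.2) ρ) = krausMap K (ptraceR ρ) := by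
  have hL' : ∀ y y', ∑ s, ∑ k, L s k y * star (L s k y') = if y' = y then 1 else 0 := by
    intro y y'
    have h := congrFun (congrFun (show ∑ i, (L i)ᴴ * L i = 1 from hL) y') y
    rw [Matrix.sum_apply, Matrix.one_apply] at h
    rw [← h]
    simp only [Matrix.mul_apply, Matrix.conjTranspose_apply, mul_comm]
  ext i j
  have lhs : ptraceR (krausMap (fun x : ι × κ => K x.1 ⊗ₖ L x.2) ρ) i j =
      ∑ t, ∑ x', ∑ y', ∑ x, ∑ y, (K t i x * ρ (x, y) (x', y') * star (K t j x')) *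
        ∑ s, ∑ k, L s k y * star (L s k y') := by
    simp only [ptraceR, krausMap, Matrix.sum_apply, Matrix.mul_apply, Fintype.sum_prod_type,
      Matrix.conjTranspose_apply, Matrix.kroneckerMap_apply, Finset.sum_mul, Finset.mul_sum]
    simp only [@Finset.sum_comm b' _ ι, @Finset.sum_comm b' _ κ, @Finset.sum_comm b' _ a,
      @Finset.sum_comm b' _ b, @Finset.sum_comm κ _ a, @Finset.sum_comm κ _ b,
      @Finset.sum_comm b _ a, star_mul']
    repeat refine Finset.sum_congr rfl fun _ _ => ?_
    ring
  rw [lhs]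
  simp only [hL', krausMap, ptraceR, Matrix.sum_apply, Matrix.mul_apply,
    Matrix.conjTranspose_apply, mul_ite, mul_one, mul_zero, Finset.sum_ite_eq, Finset.mem_univ,
    if_true, Finset.sum_mul, Finset.mul_sum]
  refine Finset.sum_congr rfl fun t _ => Finset.sum_congr rfl fun x' _ => ?_
  rw [Finset.sum_comm]

theorem ptraceL_krausMap [DecidableEq a] {K : ι → Matrix a' a ℂ} (L : κ → Matrix b' b ℂ)
    (hK : IsKrausFamily K) (ρ : Matrix (a × b) (a × b) ℂ) :
    ptraceL (krausMap (fun x : ι × κ => K x.1 ⊗ₖ L x.2) ρ) = krausMap L (ptraceL ρ) := by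
  rw [ptraceL_eq_ptraceR_swap, ptraceL_eq_ptraceR_swap, ← ptraceR_krausMap L hK]
  congr 1
  ext x y
  simp only [krausMap, Matrix.submatrix_apply, Matrix.sum_apply, Matrix.mul_apply,
    Fintype.sum_prod_type, Matrix.conjTranspose_apply, Matrix.kroneckerMap_apply,
    Prod.fst_swap, Prod.snd_swap, Prod.swap_prod_mk, Finset.sum_mul]
  simp only [@Finset.sum_comm κ _ ι, @Finset.sum_comm b _ a, star_mul']
  repeat refine Finset.sum_congr rfl fun _ _ => ?_
  ring

theorem IsKrausFamily.kronecker [DecidableEq a] [DecidableEq b] {K : ι → Matrix a' a ℂ}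
    {L : κ → Matrix b' b ℂ} (hK : IsKrausFamily K) (hL : IsKrausFamily L) :
    IsKrausFamily (fun x : ι × κ => K x.1 ⊗ₖ L x.2) := by
  have hK' : ∑ i, (K i)ᴴ * K i = 1 := hK
  have hL' : ∑ i, (L i)ᴴ * L i = 1 := hL
  rw [IsKrausFamily, ← Matrix.one_kronecker_one, ← hK', ← hL']
  simp only [Fintype.sum_prod_type, Matrix.conjTranspose_kronecker, ← Matrix.mul_kronecker_mul]
  ext x y
  simp only [Matrix.sum_apply, Matrix.kroneckerMap_apply, Finset.sum_mul_sum]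

theorem sum_normSq_col [DecidableEq a] {W : Matrix a a ℂ} (hW : Wᴴ * W = 1) (i : a) :
    ∑ x, Complex.normSq (W x i) = 1 := by
  have h := congrFun (congrFun hW i) i
  simp only [Matrix.mul_apply, Matrix.conjTranspose_apply, Matrix.one_apply_eq, Complex.star_def,
    ← Complex.normSq_eq_conj_mul_self] at h
  exact_mod_cast h

theorem mul_diagonal_mul_conjTranspose_diag [DecidableEq a] (W : Matrix a a ℂ) (p : a → ℝ)
    (x : a) : (W * diagonal (fun i => (p i : ℂ)) * Wᴴ) x x =
      ((∑ i, Complex.normSq (W x i) * p i : ℝ) : ℂ) := by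
  rw [Matrix.mul_apply]
  simp only [Matrix.mul_diagonal, Matrix.conjTranspose_apply, Complex.star_def,
    Complex.ofReal_sum, Complex.ofReal_mul, ← Complex.mul_conj]
  exact Finset.sum_congr rfl fun i _ => mul_right_comm _ _ _

theorem shannon_eq_neg_sum_mul_log_div (p : a → ℝ) :
    shannon p = -(∑ i, p i * Real.log (p i)) / Real.log 2 := by
  simp only [shannon, Real.logb, neg_div, Finset.sum_div, mul_div_assoc]

variable [DecidableEq a] [DecidableEq b]

/-- The mutual information of `ρ` as the relative entropy of `ρ` with respect to the product of
its marginals, written in eigenbases of the two matrices. -/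
theorem IsDensityMatrix.exists_qMutualInfo_eq {ρ : Matrix (a × b) (a × b) ℂ}
    (hρ : IsDensityMatrix ρ) :
    ∃ (U V : Matrix (a × b) (a × b) ℂ) (p q : a × b → ℝ),
      Uᴴ * U = 1 ∧ Vᴴ * V = 1 ∧ (∀ i, 0 ≤ p i) ∧ (∀ i, 0 ≤ q i) ∧
      ρ = U * diagonal (fun i => (p i : ℂ)) * Uᴴ ∧
      ptraceR ρ ⊗ₖ ptraceL ρ = V * diagonal (fun i => (q i : ℂ)) * Vᴴ ∧
      (∀ x : (a × b) × (a × b), Complex.normSq ((Vᴴ * U) x.1 x.2) * p x.2 ≠ 0 → 0 < q x.1) ∧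
      ∑ x : (a × b) × (a × b), Complex.normSq ((Vᴴ * U) x.1 x.2) * p x.2 = 1 ∧
      qMutualInfo ρ = (∑ x : (a × b) × (a × b), Complex.normSq ((Vᴴ * U) x.1 x.2) * p x.2 *
        (Real.log (p x.2) - Real.log (q x.1))) / Real.log 2 := by
  obtain ⟨U, p, hU, hp, hρU, hS⟩ := hρ.1.exists_eigendecomposition
  obtain ⟨A, α, hA, hα, hρA, hSA⟩ := (ptraceR_posSemidef hρ.1).exists_eigendecomposition
  obtain ⟨B, β, hB, hβ, hρB, hSB⟩ := (ptraceL_posSemidef hρ.1).exists_eigendecomposition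
  have hA' : A * Aᴴ = 1 := mul_eq_one_comm.1 hA
  have hB' : B * Bᴴ = 1 := mul_eq_one_comm.1 hB
  have hKA : IsKrausFamily (fun _ : Unit => Aᴴ) := by simpa [IsKrausFamily] using hA'
  have hKB : IsKrausFamily (fun _ : Unit => Bᴴ) := by simpa [IsKrausFamily] using hB'
  set V := A ⊗ₖ B with hV
  have hVV : Vᴴ * V = 1 := by
    rw [hV, Matrix.conjTranspose_kronecker, ← Matrix.mul_kronecker_mul, hA, hB,
      Matrix.one_kronecker_one]
  have hVV' : V * Vᴴ = 1 := mul_eq_one_comm.1 hVV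
  set W := Vᴴ * U with hW
  have hWW : Wᴴ * W = 1 := by
    rw [hW, Matrix.conjTranspose_mul, Matrix.conjTranspose_conjTranspose, Matrix.mul_assoc,
      ← Matrix.mul_assoc V, hVV', Matrix.one_mul, hU]
  set r : a × b → ℝ := fun x => ∑ i, Complex.normSq (W x i) * p i with hr
  have hr0 : ∀ x, 0 ≤ r x := fun x =>
    Finset.sum_nonneg fun i _ => mul_nonneg (Complex.normSq_nonneg _) (hp i)
  have hR : krausMap (fun _ : Unit × Unit => Aᴴ ⊗ₖ Bᴴ) ρ =
      W * diagonal (fun i => (p i : ℂ)) * Wᴴ := by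
    have hAB : Aᴴ ⊗ₖ Bᴴ = Vᴴ := (Matrix.conjTranspose_kronecker A B).symm
    simp only [krausMap, hAB, Finset.sum_const, Finset.card_univ,
      Fintype.card_prod, Fintype.card_unit, mul_one, one_smul]
    rw [hW, Matrix.conjTranspose_mul]
    conv_lhs => rw [hρU]
    simp only [Matrix.mul_assoc]
  have hdiag : ∀ x, krausMap (fun _ : Unit × Unit => Aᴴ ⊗ₖ Bᴴ) ρ x x = (r x : ℂ) := fun x => by
    rw [hR, mul_diagonal_mul_conjTranspose_diag]
  have hrA : ∀ j, ∑ k, r (j, k) = α j := by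
    intro j
    have h := congrFun (congrFun (ptraceR_krausMap (fun _ : Unit => Aᴴ) hKB ρ) j) j
    have h2 : krausMap (fun _ : Unit => Aᴴ) (ptraceR ρ) = diagonal (fun i => (α i : ℂ)) := by
      rw [hρA]
      simp only [krausMap, Finset.univ_unique, Finset.sum_singleton,
        Matrix.conjTranspose_conjTranspose, Matrix.mul_assoc, hA, Matrix.mul_one]
      rw [← Matrix.mul_assoc, hA, Matrix.one_mul]
    rw [h2, Matrix.diagonal_apply_eq] at h
    simp only [ptraceR, hdiag] at h
    exact_mod_cast h
  have hrB : ∀ k, ∑ j, r (j, k) = β k := by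
    intro j
    have h := congrFun (congrFun (ptraceL_krausMap (fun _ : Unit => Bᴴ) hKA ρ) j) j
    have h2 : krausMap (fun _ : Unit => Bᴴ) (ptraceL ρ) = diagonal (fun i => (β i : ℂ)) := by
      rw [hρB]
      simp only [krausMap, Finset.univ_unique, Finset.sum_singleton,
        Matrix.conjTranspose_conjTranspose, Matrix.mul_assoc, hB, Matrix.mul_one]
      rw [← Matrix.mul_assoc, hB, Matrix.one_mul]
    rw [h2, Matrix.diagonal_apply_eq] at h
    simp only [ptraceL, hdiag] at h
    exact_mod_cast h
  have hαpos : ∀ x, r x ≠ 0 → 0 < α x.1 := fun x hx =>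
    ((hr0 x).lt_of_ne' hx).trans_le (by
      rw [← hrA]
      exact Finset.single_le_sum (f := fun k => r (x.1, k)) (fun k _ => hr0 _)
        (Finset.mem_univ x.2))
  have hβpos : ∀ x, r x ≠ 0 → 0 < β x.2 := fun x hx =>
    ((hr0 x).lt_of_ne' hx).trans_le (by
      rw [← hrB]
      exact Finset.single_le_sum (f := fun j => r (j, x.2)) (fun k _ => hr0 _)
        (Finset.mem_univ x.1))
  have hsum : ∑ i, p i = 1 := by
    have h : ρ.trace = ∑ i, (p i : ℂ) := by
      rw [hρU, Matrix.trace_mul_comm, ← Matrix.mul_assoc, hU, Matrix.one_mul,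
        Matrix.trace_diagonal]
    rw [hρ.2] at h
    exact_mod_cast h.symm
  have hcol : ∀ f : a × b → ℝ,
      ∑ x : (a × b) × (a × b), Complex.normSq (W x.1 x.2) * f x.2 = ∑ i, f i := by
    intro f
    rw [Fintype.sum_prod_type, Finset.sum_comm]
    simp only [← Finset.sum_mul, sum_normSq_col hWW, one_mul]
  refine ⟨U, V, p, fun x => α x.1 * β x.2, hU, hVV, hp, fun x => mul_nonneg (hα _) (hβ _), hρU,
    ?_, fun x hx => ?_, ?_, ?_⟩
  · have hd : diagonal (fun x : a × b => ((α x.1 * β x.2 : ℝ) : ℂ)) =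
        diagonal (fun i => (α i : ℂ)) ⊗ₖ diagonal (fun i => (β i : ℂ)) := by
      rw [Matrix.diagonal_kronecker_diagonal]
      simp
    rw [hd, hV, Matrix.conjTranspose_kronecker, ← Matrix.mul_kronecker_mul,
      ← Matrix.mul_kronecker_mul, ← hρA, ← hρB]
  · have hrx : r x.1 ≠ 0 := by
      refine fun h => hx ?_
      exact (Finset.sum_eq_zero_iff_of_nonneg fun i _ =>
        mul_nonneg (Complex.normSq_nonneg _) (hp i)).1 h x.2 (Finset.mem_univ _)
    exact mul_pos (hαpos _ hrx) (hβpos _ hrx)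
  · rw [hcol, hsum]
  · rw [qMutualInfo, hS, hSA, hSB, shannon_eq_neg_sum_mul_log_div, shannon_eq_neg_sum_mul_log_div,
      shannon_eq_neg_sum_mul_log_div]
    have h1 : ∑ x : (a × b) × (a × b), Complex.normSq (W x.1 x.2) * p x.2 * Real.log (p x.2) =
        ∑ i, p i * Real.log (p i) := by
      rw [← hcol fun i => p i * Real.log (p i)]
      simp only [mul_assoc]
    have h2 : ∑ x : (a × b) × (a × b), Complex.normSq (W x.1 x.2) * p x.2 *
        Real.log (α x.1.1 * β x.1.2) =
        ∑ i, α i * Real.log (α i) + ∑ i, β i * Real.log (β i) := by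
      have h3 : ∀ x, r x * Real.log (α x.1 * β x.2) =
          r x * Real.log (α x.1) + r x * Real.log (β x.2) := by
        intro x
        by_cases hx : r x = 0
        · simp [hx]
        · rw [Real.log_mul (hαpos x hx).ne' (hβpos x hx).ne', mul_add]
      rw [Fintype.sum_prod_type]
      simp only [← Finset.sum_mul]
      rw [Finset.sum_congr rfl fun x _ => h3 x, Finset.sum_add_distrib, Fintype.sum_prod_type,
        Fintype.sum_prod_type_right]
      simp only [← Finset.sum_mul, hrA, hrB]
    simp only [mul_sub, Finset.sum_sub_distrib]
    rw [h1, h2]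
    ring

end Bipartite

/-- quantum mutual information is nonincreasing under local
quantum channels (given in Kraus form): S(A:B)_σ ≤ S(A:B)_ρ for
σ = (Φ_A ⊗ Φ_B)(ρ). -/
theorem stmt3 {a b a' b' ι κ : Type*}
    [Fintype a] [Fintype b] [Fintype a'] [Fintype b'] [Fintype ι] [Fintype κ]
    [DecidableEq a] [DecidableEq b] [DecidableEq a'] [DecidableEq b']
    (ρ : Matrix (a × b) (a × b) ℂ) (hρ : IsDensityMatrix ρ)
    (K : ι → Matrix a' a ℂ) (hK : IsKrausFamily K)
    (L : κ → Matrix b' b ℂ) (hL : IsKrausFamily L)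
    (σ : Matrix (a' × b') (a' × b') ℂ)
    (hσ : σ = ∑ i, ∑ s, (K i ⊗ₖ L s) * ρ * (K i ⊗ₖ L s).conjTranspose) :
    qMutualInfo σ ≤ qMutualInfo ρ := by
  have hKL := hK.kronecker hL
  have hσ' : σ = krausMap (fun x : ι × κ => K x.1 ⊗ₖ L x.2) ρ := by
    rw [hσ, krausMap, Fintype.sum_prod_type]
  have hσd : IsDensityMatrix σ := by
    rw [hσ']
    exact ⟨krausMap_posSemidef _ hρ.1, by rw [trace_krausMap hKL, hρ.2]⟩
  have hτ : ptraceR σ ⊗ₖ ptraceL σ =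
      krausMap (fun x : ι × κ => K x.1 ⊗ₖ L x.2) (ptraceR ρ ⊗ₖ ptraceL ρ) := by
    rw [krausMap_kronecker, hσ', ptraceR_krausMap K hL, ptraceL_krausMap L hK]
  have hτpos : (ptraceR ρ ⊗ₖ ptraceL ρ).PosSemidef :=
    (ptraceR_posSemidef hρ.1).kronecker (ptraceL_posSemidef hρ.1)
  obtain ⟨U, V, p, q, hU, hV, hp, hq, hρU, hτV, hsupp, hsum, hI⟩ := hρ.exists_qMutualInfo_eq
  obtain ⟨U', V', p', q', hU', hV', hp', hq', hσU, hτV', hsupp', hsum', hI'⟩ :=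
    hσd.exists_qMutualInfo_eq
  rw [hI, hI']
  refine div_le_div_of_nonneg_right ?_ (Real.log_nonneg one_le_two)
  refine sum_mul_log_sub_log_le (K := (a × b) × (a × b)) (L := (a' × b') × (a' × b'))
    _ (fun x => p x.2) (fun x => q x.1) _ (fun x => p' x.2) (fun x => q' x.1)
    (fun x hx => (hp _).lt_of_ne' (right_ne_zero_of_mul hx)) hsupp
    (fun x hx => (hp' _).lt_of_ne' (right_ne_zero_of_mul hx)) hsupp' (hsum.trans hsum'.symm)
    fun s hs => ?_
  obtain ⟨Y, hY⟩ := exists_quadForm_eq_sum hU' hV' hp' hq' hs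
  refine hY.symm.trans_le ?_
  rw [← hσU, ← hτV', hτ, hσ']
  refine (quadForm_krausMap_le hKL hρ.1 hτpos hs.le Y).trans ?_
  rw [hτV]
  conv_lhs => rw [hρU]
  exact quadForm_le_sum hU hV hp hq hs _
end
end

section
/- For d_A = 2 and M = 3 mutually unbiased bases on Alice's qubit, and any fixed POVM on Bob's side, I₁ + I₂ + I₃ ≤ 3 H{(1+R)/2, (1−R)/2} − 2, where R = √((2 Tr ρ_A² − 1)/3). -/
open Matrix BigOperators
open scoped Kronecker Classical ComplexOrder

noncomputable section

/-- Orthonormal completeness: the rank-one projectors onto the family sum to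
the identity (so the family is an orthonormal basis). -/
def IsONBasis {n ι : Type*} [Fintype n] [Fintype ι] [DecidableEq n] (v : ι → n → ℂ) : Prop :=
  (∀ i j, ∑ x, star (v i x) * v j x = if i = j then 1 else 0) ∧
  ∑ i, Matrix.vecMulVec (v i) (star (v i)) = 1

/-- Binary Shannon entropy H{p, 1-p} (base 2). -/
def H2 (p : ℝ) : ℝ := shannon ![p, 1 - p]

open Real in
theorem H2_eq_binEntropy (p : ℝ) : H2 p = binEntropy p / log 2 := by
  simp only [H2, shannon, Fin.sum_univ_two, cons_val_zero, cons_val_one, logb, binEntropy, log_inv]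
  ring

open Real in
/-- The function `artanh s / s` is increasing on `(0, 1)`. -/
theorem log_sub_log_div_le {s t : ℝ} (hs : 0 < s) (hst : s ≤ t) (ht : t < 1) :
    (log (1 + s) - log (1 - s)) / s ≤ (log (1 + t) - log (1 - t)) / t := by
  have h (x : ℝ) (h0 : 0 < x) (h1 : x < 1) :
      HasSum (fun k : ℕ => (2 : ℝ) * (1 / (2 * k + 1)) * x ^ (2 * k))
        ((log (1 + x) - log (1 - x)) / x) := by
    convert! (hasSum_log_sub_log_of_abs_lt_one
      (show |x| < 1 by rwa [abs_of_pos h0])).div_const x using 2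
    rw [pow_succ]
    field_simp
  refine hasSum_le (fun k => ?_) (h s hs (hst.trans_lt ht)) (h t (hs.trans_le hst) ht)
  gcongr

open Real in
theorem concaveOn_binEntropy_sqrt :
    ConcaveOn ℝ (Set.Icc 0 1) (fun u : ℝ => binEntropy ((1 + √u) / 2)) := by
  have hd (u : ℝ) (hu : u ∈ Set.Ioo (0 : ℝ) 1) :
      HasDerivAt (fun u : ℝ => binEntropy ((1 + √u) / 2))
        (-((log (1 + √u) - log (1 - √u)) / √u) / 4) u := by
    have h0 : 0 < √u := sqrt_pos.2 hu.1
    have h1 : √u < 1 := (sqrt_lt' one_pos).2 (by simpa using hu.2)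
    have hp : HasDerivAt (fun u : ℝ => (1 + √u) / 2) (1 / (2 * √u) / 2) u :=
      ((hasDerivAt_sqrt hu.1.ne').const_add 1).div_const 2
    have := (hasDerivAt_binEntropy (p := (1 + √u) / 2) (by linarith) (by linarith)).comp u hp
    convert! this using 1
    rw [show 1 - (1 + √u) / 2 = (1 - √u) / 2 by ring, log_div (by linarith) two_ne_zero,
      log_div (by linarith) two_ne_zero]
    field_simp
    ring
  refine AntitoneOn.concaveOn_of_deriv (convex_Icc 0 1) (by fun_prop) ?_ ?_
  · rw [interior_Icc]
    exact fun u hu => (hd u hu).differentiableAt.differentiableWithinAt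
  · rw [interior_Icc]
    intro u hu v hv huv
    rw [(hd u hu).deriv, (hd v hv).deriv]
    have := log_sub_log_div_le (sqrt_pos.2 hu.1) (sqrt_le_sqrt huv)
      ((sqrt_lt' one_pos).2 (by simpa using hv.2))
    linarith

theorem H2_half_sqrt_sq (x : ℝ) : H2 ((1 + √(x ^ 2)) / 2) = H2 ((1 + x) / 2) := by
  rw [Real.sqrt_sq_eq_abs]
  rcases abs_cases x with ⟨h, -⟩ | ⟨h, -⟩
  · rw [h]
  · rw [h, H2_eq_binEntropy, H2_eq_binEntropy, ← Real.binEntropy_one_sub]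
    ring_nf

theorem concaveOn_H2_sqrt :
    ConcaveOn ℝ (Set.Icc 0 1) (fun u : ℝ => H2 ((1 + √u) / 2)) := by
  convert! concaveOn_binEntropy_sqrt.smul (inv_nonneg.2 (Real.log_nonneg one_le_two)) using 2
  rw [H2_eq_binEntropy, smul_eq_mul, div_eq_inv_mul]

theorem H2_half_one_add_ge {x : ℝ} (hx : x ^ 2 ≤ 1) : 1 - x ^ 2 ≤ H2 ((1 + x) / 2) := by
  have h := concaveOn_H2_sqrt.2 (Set.left_mem_Icc.2 zero_le_one) (Set.right_mem_Icc.2 zero_le_one)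
    (sub_nonneg.2 hx) (sq_nonneg x) (by ring)
  have h0 : H2 ((1 + √0) / 2) = 1 := by
    have := Real.log_pos one_lt_two
    rw [H2_eq_binEntropy, Real.sqrt_zero, add_zero, one_div, Real.binEntropy_two_inv,
      div_self this.ne']
  have h1 : H2 ((1 + √1) / 2) = 0 := by
    rw [H2_eq_binEntropy, Real.sqrt_one]
    norm_num
  simp only [h0, h1, smul_eq_mul, mul_zero, mul_one, zero_add, add_zero, H2_half_sqrt_sq] at h
  exact h

theorem two_le_sum_H2 {x : Fin 3 → ℝ} (hx : ∑ m, x m ^ 2 ≤ 1) :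
    2 ≤ ∑ m, H2 ((1 + x m) / 2) := by
  have h (m : Fin 3) : 1 - x m ^ 2 ≤ H2 ((1 + x m) / 2) :=
    H2_half_one_add_ge <| (Finset.single_le_sum (f := fun m => x m ^ 2)
      (fun i _ => sq_nonneg _) (Finset.mem_univ m)).trans hx
  have := Finset.sum_le_sum fun m (_ : m ∈ Finset.univ) => h m
  simp only [Finset.sum_sub_distrib, Finset.sum_const, Finset.card_univ, Fintype.card_fin] at this
  norm_num at this
  linarith

theorem sum_H2_le {x : Fin 3 → ℝ} {R : ℝ} (hx : ∑ m, x m ^ 2 = 3 * R ^ 2)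
    (h1 : ∑ m, x m ^ 2 ≤ 1) :
    ∑ m, H2 ((1 + x m) / 2) ≤ 3 * H2 ((1 + R) / 2) := by
  have h := concaveOn_H2_sqrt.le_map_sum (t := (Finset.univ : Finset (Fin 3)))
    (w := fun _ => 1 / 3) (p := fun m => x m ^ 2) (by norm_num) (by norm_num)
    (fun m _ => ⟨sq_nonneg _, (Finset.single_le_sum (f := fun m => x m ^ 2)
      (fun i _ => sq_nonneg _) (Finset.mem_univ m)).trans h1⟩)
  simp only [smul_eq_mul, ← Finset.mul_sum, hx, H2_half_sqrt_sq] at h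
  rw [show 1 / 3 * (3 * R ^ 2) = R ^ 2 by ring, H2_half_sqrt_sq] at h
  linarith

theorem neg_mul_logb_add {a b : ℝ} (ha : 0 ≤ a) (hb : 0 ≤ b) :
    -(a * Real.logb 2 a + b * Real.logb 2 b) =
      -((a + b) * Real.logb 2 (a + b)) + (a + b) * H2 ((1 + (a - b) / (a + b)) / 2) := by
  rcases (add_nonneg ha hb).eq_or_lt with h | h
  · obtain rfl : a = 0 := by linarith
    obtain rfl : b = 0 := by linarith
    simp
  · have e1 : (1 + (a - b) / (a + b)) / 2 = a / (a + b) := by field_simp; ring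
    have e2 : 1 - a / (a + b) = b / (a + b) := by field_simp; ring
    have key {c : ℝ} : (a + b) * (c / (a + b) * Real.logb 2 (c / (a + b))) =
        c * Real.logb 2 c - c * Real.logb 2 (a + b) := by
      rcases eq_or_ne c 0 with rfl | hc
      · simp
      · rw [Real.logb_div hc h.ne']
        field_simp
    simp only [e1, H2, shannon, e2, Fin.sum_univ_two, cons_val_zero, cons_val_one]
    rw [mul_neg, mul_add, key, key]
    ring

theorem cMutualInfo_fin_two {κ : Type*} [Fintype κ] {p : Fin 2 → κ → ℝ}
    (hp : ∀ i s, 0 ≤ p i s) (h1 : ∑ s, (p 0 s + p 1 s) = 1) :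
    cMutualInfo p = H2 ((1 + ∑ s, (p 0 s - p 1 s)) / 2)
      - ∑ s, (p 0 s + p 1 s) * H2 ((1 + (p 0 s - p 1 s) / (p 0 s + p 1 s)) / 2) := by
  have hA : shannon (fun i => ∑ s, p i s) = H2 ((1 + ∑ s, (p 0 s - p 1 s)) / 2) := by
    rw [Finset.sum_add_distrib] at h1
    rw [Finset.sum_sub_distrib]
    unfold H2
    congr 1
    ext i
    fin_cases i <;> simp <;> linarith
  have hAB : shannon (fun x : Fin 2 × κ => p x.1 x.2) = shannon (fun s => ∑ i, p i s) +
      ∑ s, (p 0 s + p 1 s) * H2 ((1 + (p 0 s - p 1 s) / (p 0 s + p 1 s)) / 2) := by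
    simp only [shannon, Fintype.sum_prod_type, Fin.sum_univ_two, ← Finset.sum_add_distrib,
      ← Finset.sum_neg_distrib]
    exact Finset.sum_congr rfl fun s _ => neg_mul_logb_add (hp 0 s) (hp 1 s)
  rw [cMutualInfo, hA, hAB]
  ring

theorem sum_cMutualInfo_le {κ : Type*} [Fintype κ] {p : Fin 3 → Fin 2 → κ → ℝ} {q : κ → ℝ}
    (hp : ∀ m i s, 0 ≤ p m i s) (hq : ∀ m s, p m 0 s + p m 1 s = q s) (hq1 : ∑ s, q s = 1)
    (hpq : ∀ s, ∑ m, (p m 0 s - p m 1 s) ^ 2 ≤ q s ^ 2) {R : ℝ}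
    (hR : ∑ m, (∑ s, (p m 0 s - p m 1 s)) ^ 2 = 3 * R ^ 2)
    (h1 : ∑ m, (∑ s, (p m 0 s - p m 1 s)) ^ 2 ≤ 1) :
    ∑ m, cMutualInfo (p m) ≤ 3 * H2 ((1 + R) / 2) - 2 := by
  have hI (m : Fin 3) := cMutualInfo_fin_two (hp m) (by simpa only [hq] using hq1)
  simp only [hI, hq, Finset.sum_sub_distrib (fun m => H2 _)]
  have hcond : 2 ≤ ∑ m, ∑ s, q s * H2 ((1 + (p m 0 s - p m 1 s) / q s) / 2) := by
    rw [Finset.sum_comm]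
    calc (2 : ℝ) = ∑ s, q s * 2 := by rw [← Finset.sum_mul, hq1, one_mul]
      _ ≤ _ := Finset.sum_le_sum fun s _ => ?_
    rw [← Finset.mul_sum]
    have hq0 : 0 ≤ q s := hq 0 s ▸ add_nonneg (hp 0 0 s) (hp 0 1 s)
    refine mul_le_mul_of_nonneg_left (two_le_sum_H2 ?_) hq0
    simp only [div_pow, ← Finset.sum_div]
    exact div_le_one_of_le₀ (hpq s) (sq_nonneg _)
  linarith [sum_H2_le hR h1]

theorem ptraceR_posSemidef_s18 {a b : Type*} [Fintype a] [Fintype b]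
    {X : Matrix (a × b) (a × b) ℂ} (hX : X.PosSemidef) : (ptraceR X).PosSemidef := by
  have : ptraceR X = ∑ k, X.submatrix (fun i => (i, k)) (fun i => (i, k)) := by
    ext i j
    simp [ptraceR, Matrix.sum_apply]
  rw [this]
  exact posSemidef_sum _ fun k _ => hX.submatrix _

theorem trace_ptraceR {a b : Type*} [Fintype a] [Fintype b]
    (X : Matrix (a × b) (a × b) ℂ) : (ptraceR X).trace = X.trace := by
  simp [ptraceR, trace, Fintype.sum_prod_type]

theorem ptraceR_one_kronecker_mul_comm {a b : Type*} [Fintype a] [Fintype b] [DecidableEq a]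
    (C : Matrix b b ℂ) (X : Matrix (a × b) (a × b) ℂ) :
    ptraceR (((1 : Matrix a a ℂ) ⊗ₖ C) * X) = ptraceR (X * ((1 : Matrix a a ℂ) ⊗ₖ C)) := by
  ext i j
  simp only [ptraceR, mul_apply, kroneckerMap_apply, one_apply, Fintype.sum_prod_type,
    ite_mul, one_mul, zero_mul, mul_ite, mul_zero]
  rw [Finset.sum_congr rfl fun k _ => Finset.sum_comm]
  conv_rhs => rw [Finset.sum_congr rfl fun k _ => Finset.sum_comm]
  simp only [Finset.sum_ite_eq, Finset.sum_ite_eq', Finset.mem_univ, if_true]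
  rw [Finset.sum_comm]
  simp only [mul_comm]

theorem ptraceR_kronecker_one_mul {a b : Type*} [Fintype a] [Fintype b] [DecidableEq b]
    (P : Matrix a a ℂ) (X : Matrix (a × b) (a × b) ℂ) :
    ptraceR ((P ⊗ₖ (1 : Matrix b b ℂ)) * X) = P * ptraceR X := by
  ext i j
  simp only [ptraceR, mul_apply, kroneckerMap_apply, one_apply, Fintype.sum_prod_type,
    ite_mul, zero_mul, mul_ite, mul_zero, mul_one, Finset.sum_ite_eq, Finset.mem_univ, if_true,
    Finset.mul_sum]
  exact Finset.sum_comm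

theorem ptraceR_sum {a b ι : Type*} [Fintype a] [Fintype b] [Fintype ι]
    (X : ι → Matrix (a × b) (a × b) ℂ) : ptraceR (∑ s, X s) = ∑ s, ptraceR (X s) := by
  ext i j
  simp only [ptraceR, Matrix.sum_apply]
  exact Finset.sum_comm

/-- Alice's unnormalized state conditioned on the outcome of Bob's effect `N`. -/
def condState {a b : Type*} [Fintype a] [Fintype b] [DecidableEq a]
    (ρ : Matrix (a × b) (a × b) ℂ) (N : Matrix b b ℂ) : Matrix a a ℂ :=
  ptraceR (((1 : Matrix a a ℂ) ⊗ₖ N) * ρ)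

open scoped MatrixOrder Matrix.Norms.L2Operator in
theorem condState_posSemidef {a b : Type*} [Fintype a] [Fintype b] [DecidableEq a]
    [DecidableEq b] {ρ : Matrix (a × b) (a × b) ℂ} (hρ : ρ.PosSemidef) {N : Matrix b b ℂ}
    (hN : N.PosSemidef) : (condState ρ N).PosSemidef := by
  obtain ⟨C, rfl⟩ : ∃ C : Matrix b b ℂ, N = Cᴴ * C :=
    CStarAlgebra.nonneg_iff_eq_star_mul_self.1 hN.nonneg
  have h : (1 : Matrix a a ℂ) ⊗ₖ (Cᴴ * C) = ((1 : Matrix a a ℂ) ⊗ₖ Cᴴ) * (1 ⊗ₖ C) := by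
    rw [← mul_kronecker_mul, one_mul]
  rw [condState, h, mul_assoc, ptraceR_one_kronecker_mul_comm]
  have h2 : (1 : Matrix a a ℂ) ⊗ₖ Cᴴ = ((1 : Matrix a a ℂ) ⊗ₖ C)ᴴ := by
    rw [conjTranspose_kronecker, conjTranspose_one]
  rw [h2]
  exact ptraceR_posSemidef_s18 (hρ.mul_mul_conjTranspose_same _)

theorem measProb_eq_trace_condState {a b ι κ : Type*} [Fintype a] [Fintype b] [Fintype ι]
    [Fintype κ] [DecidableEq a] [DecidableEq b] (ρ : Matrix (a × b) (a × b) ℂ)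
    (M : ι → Matrix a a ℂ) (N : κ → Matrix b b ℂ) (i : ι) (s : κ) :
    measProb ρ M N i s = (M i * condState ρ (N s)).trace.re := by
  rw [measProb, condState, ← ptraceR_kronecker_one_mul, ← mul_assoc, ← mul_kronecker_mul,
    mul_one, one_mul, trace_ptraceR]

theorem sum_condState {a b κ : Type*} [Fintype a] [Fintype b] [Fintype κ] [DecidableEq a]
    [DecidableEq b] (ρ : Matrix (a × b) (a × b) ℂ) {N : κ → Matrix b b ℂ} (hN : ∑ s, N s = 1) :
    ∑ s, condState ρ (N s) = ptraceR ρ := by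
  simp only [condState]
  rw [← ptraceR_sum, ← Finset.sum_mul]
  have : ∑ s, (1 : Matrix a a ℂ) ⊗ₖ N s = 1 := by
    ext i j
    rw [← one_kronecker_one, ← hN]
    simp [Matrix.sum_apply, kroneckerMap_apply, Finset.mul_sum]
  rw [this, one_mul]

theorem trace_vecMulVec_mul_nonneg {n : Type*} [Fintype n] (v : n → ℂ) {σ : Matrix n n ℂ}
    (hσ : σ.PosSemidef) : 0 ≤ (vecMulVec v (star v) * σ).trace.re := by
  have : (vecMulVec v (star v) * σ).trace = star v ⬝ᵥ (σ *ᵥ v) := by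
    rw [vecMulVec_mul, trace_vecMulVec, dotProduct_comm, dotProduct_mulVec]
  rw [this]
  exact (Complex.le_def.1 (hσ.dotProduct_mulVec_nonneg v)).1

/-- The Bloch vector of the rank-one operator `|v⟩⟨v|`. -/
def blochVec (v : Fin 2 → ℂ) : Fin 3 → ℝ :=
  ![2 * (star (v 0) * v 1).re, 2 * (star (v 0) * v 1).im, ‖v 0‖ ^ 2 - ‖v 1‖ ^ 2]

theorem blochVec_dotProduct (v w : Fin 2 → ℂ) :
    blochVec v ⬝ᵥ blochVec w = 2 * ‖∑ x, star (v x) * w x‖ ^ 2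
      - (∑ x, star (v x) * v x).re * (∑ x, star (w x) * w x).re := by
  simp [blochVec, dotProduct, Fin.sum_univ_three, Fin.sum_univ_two, Complex.sq_norm,
    Complex.normSq_apply]
  ring

theorem two_mul_trace_vecMulVec_sub {v : Fin 2 → ℂ} (hv : ∑ x, star (v x) * v x = 1)
    {σ : Matrix (Fin 2) (Fin 2) ℂ} (hσ : σ.IsHermitian) :
    2 * (vecMulVec v (star v) * σ).trace.re - σ.trace.re =
      blochVec v ⬝ᵥ ![2 * (σ 0 1).re, -(2 * (σ 0 1).im), (σ 0 0).re - (σ 1 1).re] := by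
  have h := congrArg Complex.re hv
  have h10 := hσ.apply 1 0
  have h00 := congrArg Complex.im (hσ.apply 0 0)
  have h11 := congrArg Complex.im (hσ.apply 1 1)
  simp only [Complex.star_def, Complex.conj_im] at h00 h11
  have h00' : (σ 0 0).im = 0 := by linarith
  have h11' : (σ 1 1).im = 0 := by linarith
  simp [Fin.sum_univ_two] at h
  simp [blochVec, dotProduct, Fin.sum_univ_three, Fin.sum_univ_two, Complex.sq_norm,
    Complex.normSq_apply, trace, mul_apply, vecMulVec_apply, ← h10, h00', h11']
  linear_combination ((σ 0 0).re + (σ 1 1).re) * h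

theorem sum_sq_mub {B : Fin 3 → Fin 2 → Fin 2 → ℂ} (hB : ∀ m, IsONBasis (B m))
    (hMUB : ∀ m m', m ≠ m' → ∀ i j, ‖∑ x, star (B m i x) * B m' j x‖ ^ 2 = 1 / 2)
    {σ : Matrix (Fin 2) (Fin 2) ℂ} (hσ : σ.IsHermitian) :
    ∑ m, (2 * (vecMulVec (B m 0) (star (B m 0)) * σ).trace.re - σ.trace.re) ^ 2 =
      2 * (σ * σ).trace.re - σ.trace.re ^ 2 := by
  have hn (m : Fin 3) : ∑ x, star (B m 0 x) * B m 0 x = 1 := by simpa using (hB m).1 0 0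
  let O : Matrix (Fin 3) (Fin 3) ℝ := of fun m => blochVec (B m 0)
  let y : Fin 3 → ℝ := ![2 * (σ 0 1).re, -(2 * (σ 0 1).im), (σ 0 0).re - (σ 1 1).re]
  have hO : O * Oᵀ = 1 := by
    ext m m'
    change blochVec (B m 0) ⬝ᵥ blochVec (B m' 0) = _
    rw [blochVec_dotProduct, hn, hn]
    rcases eq_or_ne m m' with rfl | h
    · rw [hn]
      norm_num
    · rw [hMUB m m' h, one_apply_ne h]
      norm_num
  have hnorm : (O *ᵥ y) ⬝ᵥ (O *ᵥ y) = y ⬝ᵥ y := by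
    rw [dotProduct_mulVec, ← mulVec_transpose, mulVec_mulVec, mul_eq_one_comm.1 hO, one_mulVec]
  calc _ = (O *ᵥ y) ⬝ᵥ (O *ᵥ y) :=
        Finset.sum_congr rfl fun m _ => by
          rw [two_mul_trace_vecMulVec_sub (hn m) hσ, sq]
          rfl
    _ = y ⬝ᵥ y := hnorm
    _ = _ := by
      have h10 := hσ.apply 1 0
      have h00 := congrArg Complex.im (hσ.apply 0 0)
      have h11 := congrArg Complex.im (hσ.apply 1 1)
      simp only [Complex.star_def, Complex.conj_im] at h00 h11
      have h00' : (σ 0 0).im = 0 := by linarith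
      have h11' : (σ 1 1).im = 0 := by linarith
      simp [y, dotProduct, Fin.sum_univ_three, trace, mul_apply, Fin.sum_univ_two, ← h10, h00',
        h11']
      ring

theorem two_mul_trace_sq_sub_le {σ : Matrix (Fin 2) (Fin 2) ℂ} (hσ : σ.PosSemidef) :
    2 * (σ * σ).trace.re - σ.trace.re ^ 2 ≤ σ.trace.re ^ 2 := by
  have hdet := (Complex.le_def.1 hσ.det_nonneg).1
  have h00 := congrArg Complex.im (hσ.isHermitian.apply 0 0)
  have h11 := congrArg Complex.im (hσ.isHermitian.apply 1 1)
  simp only [Complex.star_def, Complex.conj_im] at h00 h11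
  have h00' : (σ 0 0).im = 0 := by linarith
  have h11' : (σ 1 1).im = 0 := by linarith
  simp [det_fin_two, h00', h11'] at hdet
  simp [trace, mul_apply, Fin.sum_univ_two, h00', h11']
  linarith

theorem trace_add_trace_of_isONBasis {v : Fin 2 → Fin 2 → ℂ} (hv : IsONBasis v)
    (σ : Matrix (Fin 2) (Fin 2) ℂ) :
    (vecMulVec (v 0) (star (v 0)) * σ).trace.re + (vecMulVec (v 1) (star (v 1)) * σ).trace.re =
      σ.trace.re := by
  have h := hv.2
  rw [Fin.sum_univ_two] at h
  rw [← Complex.add_re, ← trace_add, ← add_mul, h, one_mul]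

/-- for a qubit on Alice's side and three pairwise mutually
unbiased qubit bases, and any fixed POVM of Bob,
I₁ + I₂ + I₃ ≤ 3 H{(1+R)/2,(1−R)/2} − 2 with R = √((2 Tr ρ_A² − 1)/3). -/
theorem stmt18 {b κ : Type*} [Fintype b] [Fintype κ] [DecidableEq b]
    (ρ : Matrix (Fin 2 × b) (Fin 2 × b) ℂ) (hρ : IsDensityMatrix ρ)
    (B : Fin 3 → Fin 2 → Fin 2 → ℂ) (hB : ∀ m, IsONBasis (B m))
    (hMUB : ∀ m m', m ≠ m' → ∀ i j, ‖∑ x, star (B m i x) * B m' j x‖ ^ 2 = 1 / 2)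
    (N : κ → Matrix b b ℂ) (hN : IsPOVM N)
    (R : ℝ) (hR : R = Real.sqrt ((2 * ((ptraceR ρ * ptraceR ρ).trace).re - 1) / 3)) :
    ∑ m : Fin 3,
      cMutualInfo (measProb ρ (fun i => Matrix.vecMulVec (B m i) (star (B m i))) N) ≤
    3 * H2 ((1 + R) / 2) - 2 := by
  have hpt (m : Fin 3) (i : Fin 2) (s : κ) := measProb_eq_trace_condState ρ
    (fun i => vecMulVec (B m i) (star (B m i))) N i s
  have hcs (s : κ) : (condState ρ (N s)).PosSemidef := condState_posSemidef hρ.1 (hN.1 s)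
  have hρA : (ptraceR ρ).PosSemidef := ptraceR_posSemidef_s18 hρ.1
  have htr : (ptraceR ρ).trace.re = 1 := by rw [trace_ptraceR, hρ.2, Complex.one_re]
  have hadd (m : Fin 3) (σ : Matrix (Fin 2) (Fin 2) ℂ) := trace_add_trace_of_isONBasis (hB m) σ
  have hsub (m : Fin 3) (s : κ) :
      measProb ρ (fun i => vecMulVec (B m i) (star (B m i))) N 0 s -
        measProb ρ (fun i => vecMulVec (B m i) (star (B m i))) N 1 s =
      2 * (vecMulVec (B m 0) (star (B m 0)) * condState ρ (N s)).trace.re -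
        (condState ρ (N s)).trace.re := by
    rw [hpt, hpt]
    linarith [hadd m (condState ρ (N s))]
  have htrace_sum (P : Matrix (Fin 2) (Fin 2) ℂ) :
      ∑ s, (P * condState ρ (N s)).trace.re = (P * ptraceR ρ).trace.re := by
    rw [← sum_condState ρ hN.2, Finset.mul_sum, trace_sum, Complex.re_sum]
  have htrace_one : ∑ s, (condState ρ (N s)).trace.re = 1 := by
    simpa only [one_mul, htr] using htrace_sum 1
  have hmarg : ∑ m, (∑ s, (measProb ρ (fun i => vecMulVec (B m i) (star (B m i))) N 0 s -
        measProb ρ (fun i => vecMulVec (B m i) (star (B m i))) N 1 s)) ^ 2 =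
      2 * (ptraceR ρ * ptraceR ρ).trace.re - 1 := by
    have h := sum_sq_mub hB hMUB hρA.isHermitian
    rw [htr, one_pow] at h
    simp only [hsub, Finset.sum_sub_distrib, ← Finset.mul_sum, htrace_sum, htrace_one]
    exact h
  refine sum_cMutualInfo_le (q := fun s => (condState ρ (N s)).trace.re) ?_ ?_ htrace_one ?_ ?_ ?_
  · intro m i s
    rw [hpt]
    exact trace_vecMulVec_mul_nonneg _ (hcs s)
  · intro m s
    rw [hpt, hpt, hadd]
  · intro s
    simp only [hsub]
    rw [sum_sq_mub hB hMUB (hcs s).isHermitian]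
    exact two_mul_trace_sq_sub_le (hcs s)
  · have h0 : 0 ≤ 2 * (ptraceR ρ * ptraceR ρ).trace.re - 1 :=
      hmarg ▸ Finset.sum_nonneg fun m _ => sq_nonneg _
    rw [hmarg, hR, Real.sq_sqrt (by positivity)]
    ring
  · rw [hmarg]
    simpa [htr] using two_mul_trace_sq_sub_le hρA
end
end
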